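/- Let Ω ⊂ ℝⁿ be an (ε,δ)-domain, λ := λ_{ε,δ}, and f ∈ bmo_λ(Ω). Then the following are equivalent: (i) there exist continuous functions g_j with compact support in Ω such that ‖f − g_j‖_{bmo_λ(Ω)} → 0; (ii) there exist C^∞ functions g_j with compact support in Ω such that ‖f − g_j‖_{bmo_λ(Ω)} → 0; (iii) f vanishes at infinity, i.e., lim_{R→∞} ‖f‖_{bmo_λ(Ω ∖ closure(B(0,R)))} = 0, and lim_{t→0⁺} ω_Ω(f,t) = 0. -/

import Mathlib

open MeasureTheory Metric Filter Topology

noncomputable section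

/-- A closed axis-parallel cube in ℝⁿ: a closed ball in the sup norm with
positive radius (`half` = half the sidelength). -/
structure Cube (n : ℕ) where
  center : Fin n → ℝ
  half : ℝ
  half_pos : 0 < half

namespace Cube

variable {n : ℕ}

/-- The underlying set of a cube. -/
def toSet (Q : Cube n) : Set (Fin n → ℝ) := Metric.closedBall Q.center Q.half

/-- The sidelength ℓ(Q). -/
def side (Q : Cube n) : ℝ := 2 * Q.half

/-- The mean f_Q of f over Q. -/
def avg (Q : Cube n) (f : (Fin n → ℝ) → ℝ) : ℝ := ⨍ x in Q.toSet, f x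

/-- Mean oscillation of f over Q. -/
def osc (Q : Cube n) (f : (Fin n → ℝ) → ℝ) : ℝ := ⨍ x in Q.toSet, |f x - Q.avg f|

/-- The mean |f|_Q of |f| over Q. -/
def avgAbs (Q : Cube n) (f : (Fin n → ℝ) → ℝ) : ℝ := ⨍ x in Q.toSet, |f x|

/-- Distance from the cube to the origin. -/
def distToOrigin (Q : Cube n) : ℝ := Metric.infDist (0 : Fin n → ℝ) Q.toSet

/-- The cube 2Q, concentric with Q and of twice the sidelength. -/
def double (Q : Cube n) : Cube n := ⟨Q.center, 2 * Q.half, mul_pos two_pos Q.half_pos⟩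

end Cube

variable {n : ℕ}

/-- The modulus of mean oscillation ω_U(f,t): the supremum of the mean oscillation
of f over cubes Q ⊆ U of sidelength < t. -/
def omegaOn (U : Set (Fin n → ℝ)) (f : (Fin n → ℝ) → ℝ) (t : ℝ) : ℝ :=
  sSup {r | ∃ Q : Cube n, Q.toSet ⊆ U ∧ Q.side < t ∧ r = Q.osc f}

/-- sup{ |f|_Q : Q ⊆ U, ℓ(Q) ≥ lam }. -/
def bigAvgSup (U : Set (Fin n → ℝ)) (lam : ℝ) (f : (Fin n → ℝ) → ℝ) : ℝ :=
  sSup {r | ∃ Q : Cube n, Q.toSet ⊆ U ∧ lam ≤ Q.side ∧ r = Q.avgAbs f}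

/-- The nonhomogeneous norm ‖f‖_{bmo_lam(U)}. -/
def bmoNorm (U : Set (Fin n → ℝ)) (lam : ℝ) (f : (Fin n → ℝ) → ℝ) : ℝ :=
  omegaOn U f lam + bigAvgSup U lam f

/-- Membership in bmo_lam(U): integrable on every cube in U and finite norm. -/
def MemBmo (U : Set (Fin n → ℝ)) (lam : ℝ) (f : (Fin n → ℝ) → ℝ) : Prop :=
  (∀ Q : Cube n, Q.toSet ⊆ U → IntegrableOn f Q.toSet) ∧
  BddAbove {r | ∃ Q : Cube n, Q.toSet ⊆ U ∧ Q.side < lam ∧ r = Q.osc f} ∧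
  BddAbove {r | ∃ Q : Cube n, Q.toSet ⊆ U ∧ lam ≤ Q.side ∧ r = Q.avgAbs f}

/-- Sarason's vanishing mean oscillation condition: ω_U(f,t) → 0 as t → 0⁺. -/
def VanishSmallOsc (U : Set (Fin n → ℝ)) (f : (Fin n → ℝ) → ℝ) : Prop :=
  Tendsto (fun t => omegaOn U f t) (nhdsWithin 0 (Set.Ioi 0)) (nhds 0)

/-- f is bounded on U. -/
def BoundedOn (U : Set (Fin n → ℝ)) (f : (Fin n → ℝ) → ℝ) : Prop :=
  ∃ M : ℝ, ∀ x ∈ U, |f x| ≤ M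

/-- f is Lipschitz on U. -/
def LipschitzOn (U : Set (Fin n → ℝ)) (f : (Fin n → ℝ) → ℝ) : Prop :=
  ∃ K : NNReal, LipschitzOnWith K f U

/-- dist(supp f, ∂U) > 0. -/
def SuppAway (U : Set (Fin n → ℝ)) (f : (Fin n → ℝ) → ℝ) : Prop :=
  ∃ d > 0, ∀ x ∈ Function.support f, ∀ y ∈ frontier U, d ≤ dist x y

/-- The nonhomogeneous Lipschitz norm ‖f‖_{Lip_b(U)} = ‖f‖_∞ + Lipschitz seminorm. -/
def lipbNorm (U : Set (Fin n → ℝ)) (f : (Fin n → ℝ) → ℝ) : ℝ :=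
  sSup {r | ∃ x ∈ U, r = |f x|} +
  sSup {r | ∃ x ∈ U, ∃ y ∈ U, x ≠ y ∧ r = |f x - f y| / dist x y}

/-- U is a domain: a nonempty open connected subset of ℝⁿ. -/
def IsRealDomain (U : Set (Fin n → ℝ)) : Prop := IsOpen U ∧ IsConnected U

/-- U is an (ε,δ)-domain. -/
def IsEpsDeltaDomain (U : Set (Fin n → ℝ)) (ε δ : ℝ) : Prop :=
  ∀ x ∈ U, ∀ y ∈ U, dist x y < δ →
    ∃ γ : ℝ → (Fin n → ℝ), ContinuousOn γ (Set.Icc 0 1) ∧ γ 0 = x ∧ γ 1 = y ∧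
      (∀ t ∈ Set.Icc (0:ℝ) 1, γ t ∈ U) ∧
      eVariationOn γ (Set.Icc 0 1) ≤ ENNReal.ofReal (ε⁻¹ * dist x y) ∧
      ∀ t ∈ Set.Icc (0:ℝ) 1,
        ε * (dist (γ t) x * dist (γ t) y) / dist x y ≤ Metric.infDist (γ t) (frontier U)

/-- The natural scale λ_{ε,δ} for an (ε,δ)-domain. -/
def lamED (n : ℕ) (ε δ : ℝ) : ℝ := ε ^ 2 * δ / (320 * n * (1 + Real.sqrt n * ε))

/-- d_Ω(x) = dist(x,∂Ω). -/
def distBd (U : Set (Fin n → ℝ)) (x : Fin n → ℝ) : ℝ := Metric.infDist x (frontier U)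

/-- Ω̊_t = {x ∈ Ω : d_Ω(x) ≥ t}. -/
def innerPart (U : Set (Fin n → ℝ)) (t : ℝ) : Set (Fin n → ℝ) :=
  {x ∈ U | t ≤ distBd U x}

/-- f vanishes at infinity in the bmo_lam(U) sense. -/
def VanishAtInfinity (U : Set (Fin n → ℝ)) (lam : ℝ) (f : (Fin n → ℝ) → ℝ) : Prop :=
  Tendsto (fun R => bmoNorm (U \ Metric.closedBall 0 R) lam f) atTop (nhds 0)

/-- f vanishes at the boundary in the bmo_lam(U) sense. -/
def VanishAtBoundary (U : Set (Fin n → ℝ)) (lam : ℝ) (f : (Fin n → ℝ) → ℝ) : Prop :=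
  Tendsto (fun t => bmoNorm (U \ innerPart U t) lam f) (nhdsWithin 0 (Set.Ioi 0)) (nhds 0)

/-- f is in the bmo_lam(U)-closure of the continuous functions with compact support in U. -/
def InCmoClosure (U : Set (Fin n → ℝ)) (lam : ℝ) (f : (Fin n → ℝ) → ℝ) : Prop :=
  ∃ g : ℕ → (Fin n → ℝ) → ℝ,
    (∀ j, Continuous (g j) ∧ HasCompactSupport (g j) ∧ tsupport (g j) ⊆ U) ∧
    Tendsto (fun j => bmoNorm U lam (f - g j)) atTop (nhds 0)

/-- The homogeneous BMO(ℝⁿ) seminorm: sup of mean oscillation over all cubes. -/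
def bmoHNorm (f : (Fin n → ℝ) → ℝ) : ℝ := sSup {r | ∃ Q : Cube n, r = Q.osc f}

namespace Cube

theorem side_pos (Q : Cube n) : 0 < Q.side := mul_pos two_pos Q.half_pos

theorem measurableSet_toSet (Q : Cube n) : MeasurableSet Q.toSet :=
  measurableSet_closedBall

theorem isCompact_toSet (Q : Cube n) : IsCompact Q.toSet := isCompact_closedBall _ _

theorem volume_toSet (Q : Cube n) : volume Q.toSet = ENNReal.ofReal (Q.side ^ n) := by
  simp [toSet, side, Real.volume_pi_closedBall _ Q.half_pos.le]

theorem measureReal_toSet (Q : Cube n) : volume.real Q.toSet = Q.side ^ n := by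
  rw [measureReal_def, volume_toSet, ENNReal.toReal_ofReal (pow_nonneg Q.side_pos.le n)]

theorem avg_eq (Q : Cube n) (f : (Fin n → ℝ) → ℝ) :
    Q.avg f = (Q.side ^ n)⁻¹ * ∫ x in Q.toSet, f x := by
  rw [avg, setAverage_eq, measureReal_toSet, smul_eq_mul]

theorem avgAbs_eq (Q : Cube n) (f : (Fin n → ℝ) → ℝ) :
    Q.avgAbs f = (Q.side ^ n)⁻¹ * ∫ x in Q.toSet, |f x| := avg_eq Q _

theorem osc_eq (Q : Cube n) (f : (Fin n → ℝ) → ℝ) :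
    Q.osc f = Q.avgAbs (fun x => f x - Q.avg f) := rfl

theorem integral_abs_eq (Q : Cube n) (f : (Fin n → ℝ) → ℝ) :
    ∫ x in Q.toSet, |f x| = Q.side ^ n * Q.avgAbs f := by
  have := (pow_pos Q.side_pos n).ne'
  rw [avgAbs_eq]; field_simp

theorem avgAbs_nonneg (Q : Cube n) (f : (Fin n → ℝ) → ℝ) : 0 ≤ Q.avgAbs f := by
  rw [avgAbs_eq]
  exact mul_nonneg (inv_nonneg.2 (pow_nonneg Q.side_pos.le n))
    (integral_nonneg fun _ => abs_nonneg _)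

theorem osc_nonneg (Q : Cube n) (f : (Fin n → ℝ) → ℝ) : 0 ≤ Q.osc f := avgAbs_nonneg Q _

theorem integrableOn_const (Q : Cube n) (a : ℝ) : IntegrableOn (fun _ => a) Q.toSet :=
  continuousOn_const.integrableOn_compact Q.isCompact_toSet

theorem avgAbs_le_of_forall_le {Q : Cube n} {f : (Fin n → ℝ) → ℝ} {M : ℝ}
    (hf : IntegrableOn f Q.toSet) (h : ∀ x ∈ Q.toSet, |f x| ≤ M) : Q.avgAbs f ≤ M := by
  have hs := pow_pos Q.side_pos n
  rw [avgAbs_eq, inv_mul_le_iff₀ hs]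
  calc ∫ x in Q.toSet, |f x| ≤ ∫ _ in Q.toSet, M :=
        setIntegral_mono_on hf.abs (Q.integrableOn_const M) Q.measurableSet_toSet h
    _ = Q.side ^ n * M := by simp [measureReal_toSet]

theorem avgAbs_le_add {Q : Cube n} {f g h : (Fin n → ℝ) → ℝ}
    (hf : IntegrableOn f Q.toSet) (hg : IntegrableOn g Q.toSet) (hh : IntegrableOn h Q.toSet)
    (H : ∀ x ∈ Q.toSet, |f x| ≤ |g x| + |h x|) : Q.avgAbs f ≤ Q.avgAbs g + Q.avgAbs h := by
  rw [avgAbs_eq, avgAbs_eq, avgAbs_eq, ← mul_add]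
  refine mul_le_mul_of_nonneg_left ?_ (inv_nonneg.2 (pow_nonneg Q.side_pos.le n))
  rw [← integral_add hg.abs hh.abs]
  exact setIntegral_mono_on hf.abs (hg.abs.add hh.abs) Q.measurableSet_toSet H

theorem avgAbs_const (Q : Cube n) (a : ℝ) : Q.avgAbs (fun _ => a) = |a| := by
  have := (pow_pos Q.side_pos n).ne'
  rw [avgAbs_eq]; simp [measureReal_toSet]; field_simp

theorem integral_sub_const (Q : Cube n) {f : (Fin n → ℝ) → ℝ} (hf : IntegrableOn f Q.toSet)
    (a : ℝ) : ∫ x in Q.toSet, (f x - a) = Q.side ^ n * (Q.avg f - a) := by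
  have := (pow_pos Q.side_pos n).ne'
  rw [integral_sub hf (Q.integrableOn_const a), avg_eq]
  simp [measureReal_toSet]; field_simp

/-- The mean over a subcube is controlled by the mean deviation over the larger cube. -/
theorem abs_avg_sub_le {P Q : Cube n} (hPQ : P.toSet ⊆ Q.toSet) {f : (Fin n → ℝ) → ℝ}
    (hf : IntegrableOn f Q.toSet) (a : ℝ) :
    |P.avg f - a| ≤ (Q.side / P.side) ^ n * Q.avgAbs (fun x => f x - a) := by
  have hP := pow_pos P.side_pos n
  have hQ := pow_pos Q.side_pos n
  have h1 := P.integral_sub_const (hf.mono_set hPQ) a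
  have h2 : |∫ x in P.toSet, (f x - a)| ≤ ∫ x in Q.toSet, |f x - a| :=
    abs_integral_le_integral_abs.trans
      (setIntegral_mono_set (hf.sub (Q.integrableOn_const a)).abs
        (Eventually.of_forall fun _ => abs_nonneg _) hPQ.eventuallyLE)
  rw [h1, abs_mul, abs_of_pos hP, Q.integral_abs_eq (fun x => f x - a)] at h2
  rw [div_pow, div_mul_eq_mul_div, le_div_iff₀ hP]
  linarith

theorem abs_avg_le_avgAbs {P Q : Cube n} (hPQ : P.toSet ⊆ Q.toSet) {f : (Fin n → ℝ) → ℝ}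
    (hf : IntegrableOn f Q.toSet) :
    |P.avg f| ≤ (Q.side / P.side) ^ n * Q.avgAbs f := by
  simpa using abs_avg_sub_le hPQ hf 0

theorem abs_avg_sub_le_self (Q : Cube n) {f : (Fin n → ℝ) → ℝ}
    (hf : IntegrableOn f Q.toSet) (a : ℝ) :
    |Q.avg f - a| ≤ Q.avgAbs (fun x => f x - a) := by
  simpa [div_self Q.side_pos.ne'] using abs_avg_sub_le subset_rfl hf a

theorem abs_avg_sub_avg_le_osc {P Q : Cube n} (hPQ : P.toSet ⊆ Q.toSet) {f : (Fin n → ℝ) → ℝ}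
    (hf : IntegrableOn f Q.toSet) :
    |P.avg f - Q.avg f| ≤ (Q.side / P.side) ^ n * Q.osc f :=
  abs_avg_sub_le hPQ hf _

theorem abs_avg_sub_avg_le {P P' Q : Cube n} (hPQ : P.toSet ⊆ Q.toSet) (hPQ' : P'.toSet ⊆ Q.toSet)
    {f : (Fin n → ℝ) → ℝ} (hf : IntegrableOn f Q.toSet) {K : ℝ}
    (hP : Q.side ≤ K * P.side) (hP' : Q.side ≤ K * P'.side) :
    |P.avg f - P'.avg f| ≤ 2 * K ^ n * Q.osc f := by
  have h0 := Q.osc_nonneg f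
  have key : ∀ {R : Cube n}, R.toSet ⊆ Q.toSet → Q.side ≤ K * R.side →
      |R.avg f - Q.avg f| ≤ K ^ n * Q.osc f := fun {R} hR hK =>
    (abs_avg_sub_avg_le_osc hR hf).trans <| mul_le_mul_of_nonneg_right
      (pow_le_pow_left₀ (div_nonneg Q.side_pos.le R.side_pos.le)
        ((div_le_iff₀ R.side_pos).2 hK) n) h0
  have h1 := key hPQ hP
  have h2 := key hPQ' hP'
  rw [abs_sub_comm] at h2
  have := abs_sub_le (P.avg f) (Q.avg f) (P'.avg f)
  linarith

theorem osc_le_two_mul (Q : Cube n) {f : (Fin n → ℝ) → ℝ} (hf : IntegrableOn f Q.toSet) (a : ℝ) :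
    Q.osc f ≤ 2 * Q.avgAbs (fun x => f x - a) := by
  have h1 := Q.abs_avg_sub_le_self hf a
  have h2 : Q.osc f ≤ Q.avgAbs (fun x => f x - a) + Q.avgAbs (fun _ => Q.avg f - a) :=
    avgAbs_le_add (hf.sub (Q.integrableOn_const _)) (hf.sub (Q.integrableOn_const _))
      (Q.integrableOn_const _) fun x _ => by
        have := abs_sub_le (f x) a (Q.avg f)
        rwa [abs_sub_comm a] at this
  rw [avgAbs_const] at h2
  linarith

theorem osc_le_two_mul_avgAbs (Q : Cube n) {f : (Fin n → ℝ) → ℝ} (hf : IntegrableOn f Q.toSet) :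
    Q.osc f ≤ 2 * Q.avgAbs f := by
  simpa using Q.osc_le_two_mul hf 0

theorem avgAbs_le_osc_add (Q : Cube n) {f : (Fin n → ℝ) → ℝ} (hf : IntegrableOn f Q.toSet) :
    Q.avgAbs f ≤ Q.osc f + |Q.avg f| := by
  rw [← Q.avgAbs_const (Q.avg f)]
  exact avgAbs_le_add hf (hf.sub (Q.integrableOn_const _)) (Q.integrableOn_const _) fun x _ => by
    simpa using abs_add_le (f x - Q.avg f) (Q.avg f)

theorem avg_sub (Q : Cube n) {f g : (Fin n → ℝ) → ℝ} (hf : IntegrableOn f Q.toSet)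
    (hg : IntegrableOn g Q.toSet) : Q.avg (f - g) = Q.avg f - Q.avg g := by
  rw [avg_eq, avg_eq, avg_eq, ← mul_sub, ← integral_sub hf hg]
  rfl

theorem osc_le_add_osc_sub (Q : Cube n) {f g : (Fin n → ℝ) → ℝ} (hf : IntegrableOn f Q.toSet)
    (hg : IntegrableOn g Q.toSet) : Q.osc f ≤ Q.osc (f - g) + Q.osc g := by
  refine avgAbs_le_add (hf.sub (Q.integrableOn_const _))
    ((hf.sub hg).sub (Q.integrableOn_const _)) (hg.sub (Q.integrableOn_const _)) fun x _ => ?_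
  rw [avg_sub Q hf hg, Pi.sub_apply]
  exact (congrArg _ (by ring)).le.trans (abs_add_le _ _)

theorem osc_sub_le (Q : Cube n) {f g : (Fin n → ℝ) → ℝ} (hf : IntegrableOn f Q.toSet)
    (hg : IntegrableOn g Q.toSet) : Q.osc (f - g) ≤ Q.osc f + Q.osc g := by
  refine avgAbs_le_add ((hf.sub hg).sub (Q.integrableOn_const _))
    (hf.sub (Q.integrableOn_const _)) (hg.sub (Q.integrableOn_const _)) fun x _ => ?_
  rw [avg_sub Q hf hg, Pi.sub_apply]
  exact (congrArg _ (by ring)).le.trans (abs_sub (f x - Q.avg f) (g x - Q.avg g))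

theorem avg_congr {Q : Cube n} {f g : (Fin n → ℝ) → ℝ} (h : Set.EqOn f g Q.toSet) :
    Q.avg f = Q.avg g := by
  rw [avg_eq, avg_eq, setIntegral_congr_fun Q.measurableSet_toSet h]

theorem osc_congr {Q : Cube n} {f g : (Fin n → ℝ) → ℝ} (h : Set.EqOn f g Q.toSet) :
    Q.osc f = Q.osc g := by
  rw [osc_eq, osc_eq, avg_congr h]
  exact avg_congr fun x hx => by simp [h hx]

theorem avgAbs_congr {Q : Cube n} {f g : (Fin n → ℝ) → ℝ} (h : Set.EqOn f g Q.toSet) :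
    Q.avgAbs f = Q.avgAbs g :=
  avg_congr fun x hx => by simp [h hx]

theorem avgAbs_le_of_lintegral_le {Q : Cube n} {f : (Fin n → ℝ) → ℝ} {M : ℝ} (hM : 0 ≤ M)
    (hf : IntegrableOn f Q.toSet)
    (h : ∫⁻ x in Q.toSet, ENNReal.ofReal |f x| ≤ ENNReal.ofReal M * volume Q.toSet) :
    Q.avgAbs f ≤ M := by
  have hs := pow_pos Q.side_pos n
  rw [avgAbs_eq, inv_mul_le_iff₀ hs, integral_eq_lintegral_of_nonneg_ae
    (Eventually.of_forall fun _ => abs_nonneg _) hf.abs.aestronglyMeasurable]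
  rw [volume_toSet, ← ENNReal.ofReal_mul hM, mul_comm] at h
  exact ENNReal.toReal_le_of_le_ofReal (by positivity) h

theorem lintegral_le_of_avgAbs_le {Q : Cube n} {f : (Fin n → ℝ) → ℝ} {M : ℝ}
    (hf : IntegrableOn f Q.toSet) (h : Q.avgAbs f ≤ M) :
    ∫⁻ x in Q.toSet, ENNReal.ofReal |f x| ≤ ENNReal.ofReal M * volume Q.toSet := by
  have hs := pow_pos Q.side_pos n
  have hM := (Q.avgAbs_nonneg f).trans h
  rw [avgAbs_eq, inv_mul_le_iff₀ hs] at h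
  rw [← ofReal_integral_eq_lintegral_ofReal hf.abs (Eventually.of_forall fun _ => abs_nonneg _),
    volume_toSet, ← ENNReal.ofReal_mul hM, mul_comm]
  exact ENNReal.ofReal_le_ofReal h

end Cube

namespace Cube

theorem volume_shell_le (hn : 0 < n) (Q : Cube n) {σ : ℝ} (hσ : 0 ≤ σ) :
    volume ({x | Q.half * (1 - σ) < dist x Q.center} ∩ Q.toSet) ≤
      ENNReal.ofReal (n * σ) * volume Q.toSet := by
  have hh := Q.half_pos
  have hs := pow_pos Q.side_pos n
  rcases le_or_gt σ 1 with h1 | h1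
  · have hr : 0 ≤ Q.half * (1 - σ) := mul_nonneg hh.le (by linarith)
    have hsub : closedBall Q.center (Q.half * (1 - σ)) ⊆ Q.toSet :=
      closedBall_subset_closedBall (by nlinarith)
    have hset : {x | Q.half * (1 - σ) < dist x Q.center} ∩ Q.toSet
        = Q.toSet \ closedBall Q.center (Q.half * (1 - σ)) := by
      ext x; simp [and_comm]
    rw [hset, measure_sdiff hsub measurableSet_closedBall.nullMeasurableSet
      measure_closedBall_lt_top.ne, volume_toSet, Real.volume_pi_closedBall _ hr,
      ← ENNReal.ofReal_sub _ (by positivity), ← ENNReal.ofReal_mul (by positivity)]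
    refine ENNReal.ofReal_le_ofReal ?_
    have hb := one_add_mul_le_pow (a := -σ) (by linarith) n
    rw [Fintype.card_fin, show 2 * (Q.half * (1 - σ)) = Q.side * (1 + -σ) by
      rw [side]; ring, mul_pow]
    nlinarith
  · refine (measure_mono Set.inter_subset_right).trans ?_
    refine le_mul_of_one_le_left (by positivity) ?_
    rw [ENNReal.one_le_ofReal]
    have : (1 : ℝ) ≤ n := by exact_mod_cast hn
    nlinarith

/-- Chaining towards the center: a function that varies little on Whitney balls of a cube differs
from its value at the center by at most the number of dyadic layers in between. -/
theorem abs_sub_center_le (Q : Cube n) {g : (Fin n → ℝ) → ℝ} {η : ℝ}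
    (H : ∀ x y, dist x Q.center < Q.half → dist x y ≤ (Q.half - dist x Q.center) / 4 →
      |g x - g y| ≤ η) {x : Fin n → ℝ} (hx : dist x Q.center < Q.half) {K : ℕ}
    (hK : Q.half * (3 * (3 / 4) ^ K) ≤ Q.half - dist x Q.center) :
    |g x - g Q.center| ≤ (K + 1) * η := by
  set p : ℕ → Fin n → ℝ := fun k => AffineMap.lineMap Q.center x (1 - (3 / 4 : ℝ) ^ k) with hp
  have hd : 0 ≤ dist x Q.center := dist_nonneg
  have hσ : ∀ k : ℕ, 0 < (3 / 4 : ℝ) ^ k ∧ (3 / 4 : ℝ) ^ k ≤ 1 := fun k =>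
    ⟨by positivity, pow_le_one₀ (by norm_num) (by norm_num)⟩
  have hpc : ∀ k, dist (p k) Q.center = (1 - (3 / 4 : ℝ) ^ k) * dist x Q.center := fun k => by
    rw [hp, dist_lineMap_left, dist_comm, Real.norm_of_nonneg (by linarith [(hσ k).2])]
  have hpx : ∀ k, dist (p k) x = (3 / 4 : ℝ) ^ k * dist x Q.center := fun k => by
    rw [hp, dist_lineMap_right, dist_comm, sub_sub_cancel, Real.norm_of_nonneg (hσ k).1.le]
  have hpp : ∀ k, dist (p k) (p (k + 1)) = (3 / 4 : ℝ) ^ k / 4 * dist x Q.center := fun k => by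
    rw [hp, dist_lineMap_lineMap, dist_comm Q.center, Real.dist_eq, abs_sub_comm, abs_of_nonneg]
    · ring
    · rw [pow_succ]; linarith [(hσ k).1]
  have hlt : ∀ k, dist (p k) Q.center < Q.half := fun k => by
    rw [hpc]; nlinarith [hσ k]
  have hstep : ∀ k : ℕ, |g (p k) - g Q.center| ≤ k * η := by
    intro k
    induction k with
    | zero => simp [hp]
    | succ k ih =>
      have h1 := H (p k) (p (k + 1)) (hlt k) (by rw [hpp, hpc]; nlinarith [hσ k])
      rw [abs_sub_comm] at h1
      have h2 := abs_sub_le (g (p (k + 1))) (g (p k)) (g Q.center)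
      push_cast
      linarith
  have h1 := H (p K) x (hlt K) (by rw [hpx, hpc]; nlinarith [hσ K])
  rw [abs_sub_comm] at h1
  have h2 := abs_sub_le (g x) (g (p K)) (g Q.center)
  linarith [hstep K]

/-- Local-to-global: a function that varies by at most `η` on Whitney balls of a cube has mean
deviation from its value at the center comparable to `η`. -/
theorem avgAbs_sub_center_le (hn : 0 < n) (Q : Cube n) {g : (Fin n → ℝ) → ℝ}
    (hg : IntegrableOn g Q.toSet) {η : ℝ} (hη : 0 ≤ η)
    (H : ∀ x y, dist x Q.center < Q.half → dist x y ≤ (Q.half - dist x Q.center) / 4 →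
      |g x - g y| ≤ η) :
    Q.avgAbs (fun x => g x - g Q.center) ≤ (12 * n + 1) * η := by
  have hh := Q.half_pos
  refine avgAbs_le_of_lintegral_le (by positivity) (hg.sub (Q.integrableOn_const _)) ?_
  set E : ℕ → Set (Fin n → ℝ) := fun k =>
    {x | Q.half * (1 - 3 * (3 / 4 : ℝ) ^ k) < dist x Q.center} with hE
  have hEm : ∀ k, MeasurableSet (E k) := fun k =>
    measurableSet_lt measurable_const (measurable_id.dist measurable_const)
  have hpt : ∀ x, dist x Q.center < Q.half → ENNReal.ofReal |g x - g Q.center| ≤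
      ENNReal.ofReal η + ∑' k, (E k).indicator (fun _ => ENNReal.ofReal η) x := by
    intro x hx
    have hex : ∃ K : ℕ, Q.half * (3 * (3 / 4 : ℝ) ^ K) ≤ Q.half - dist x Q.center := by
      obtain ⟨K, hK⟩ := exists_pow_lt_of_lt_one
        (show 0 < (Q.half - dist x Q.center) / (3 * Q.half) from
          div_pos (by linarith) (by linarith)) (show (3 / 4 : ℝ) < 1 by norm_num)
      rw [lt_div_iff₀ (by linarith)] at hK
      exact ⟨K, by linarith⟩
    have hmem : ∀ k < Nat.find hex, x ∈ E k := fun k hk => by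
      have := Nat.find_min hex hk
      simp only [hE, Set.mem_ofPred_eq]
      linarith
    calc ENNReal.ofReal |g x - g Q.center|
        ≤ ENNReal.ofReal ((Nat.find hex + 1) * η) :=
          ENNReal.ofReal_le_ofReal (Q.abs_sub_center_le H hx (Nat.find_spec hex))
      _ = ENNReal.ofReal η +
          ∑ k ∈ Finset.range (Nat.find hex), (E k).indicator (fun _ => ENNReal.ofReal η) x := by
        rw [Finset.sum_congr rfl fun k hk => Set.indicator_of_mem (hmem k (Finset.mem_range.1 hk)) _,
          Finset.sum_const, Finset.card_range, nsmul_eq_mul, add_mul, one_mul, add_comm,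
          ENNReal.ofReal_add hη (by positivity), ENNReal.ofReal_mul (by positivity),
          ENNReal.ofReal_natCast]
      _ ≤ _ := by gcongr; exact ENNReal.sum_le_tsum _
  have hae : ∀ᵐ x ∂volume.restrict Q.toSet, dist x Q.center < Q.half := by
    have h0 : volume (sphere Q.center Q.half) = 0 :=
      Measure.addHaar_sphere_of_ne_zero _ _ hh.ne'
    have h1 : ∀ᵐ x ∂volume.restrict Q.toSet, x ∉ sphere Q.center Q.half :=
      ae_restrict_of_ae (measure_eq_zero_iff_ae_notMem.1 h0)
    filter_upwards [h1, ae_restrict_mem Q.measurableSet_toSet] with x hx hxQ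
    exact lt_of_le_of_ne hxQ hx
  have hsum : ∑' k : ℕ, ENNReal.ofReal (n * (3 * (3 / 4 : ℝ) ^ k)) = ENNReal.ofReal (12 * n) := by
    have hs : Summable fun k : ℕ => (3 / 4 : ℝ) ^ k :=
      summable_geometric_of_lt_one (by norm_num) (by norm_num)
    rw [← ENNReal.ofReal_tsum_of_nonneg (fun k => by positivity)
      ((hs.mul_left 3).mul_left _), tsum_mul_left, tsum_mul_left,
      tsum_geometric_of_lt_one (by norm_num) (by norm_num)]
    congr 1
    norm_num
    ring
  calc ∫⁻ x in Q.toSet, ENNReal.ofReal |g x - g Q.center|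
      ≤ ∫⁻ x in Q.toSet, (ENNReal.ofReal η +
          ∑' k, (E k).indicator (fun _ => ENNReal.ofReal η) x) :=
        lintegral_mono_ae (hae.mono hpt)
    _ = ENNReal.ofReal η * volume Q.toSet +
          ∑' k, ENNReal.ofReal η * volume (E k ∩ Q.toSet) := by
        rw [lintegral_add_left measurable_const,
          lintegral_tsum fun k => (measurable_const.indicator (hEm k)).aemeasurable,
          setLIntegral_const]
        congr 1
        refine tsum_congr fun k => ?_
        rw [lintegral_indicator (hEm k), setLIntegral_const, Measure.restrict_apply (hEm k)]
    _ ≤ ENNReal.ofReal η * volume Q.toSet +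
          ∑' k : ℕ, ENNReal.ofReal η *
            (ENNReal.ofReal (n * (3 * (3 / 4 : ℝ) ^ k)) * volume Q.toSet) := by
        gcongr with k
        exact Q.volume_shell_le hn (by positivity)
    _ = ENNReal.ofReal ((12 * n + 1) * η) * volume Q.toSet := by
        rw [ENNReal.tsum_mul_left, ENNReal.tsum_mul_right, hsum,
          ENNReal.ofReal_mul (show (0 : ℝ) ≤ 12 * n + 1 by positivity),
          ENNReal.ofReal_add (by positivity) zero_le_one, ENNReal.ofReal_one]
        ring

/-- The `2ⁿ` cubes obtained by bisecting a cube. -/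
def bisect (Q : Cube n) (s : Fin n → Bool) : Cube n :=
  ⟨fun i => Q.center i + (if s i then Q.half / 2 else -(Q.half / 2)), Q.half / 2,
    _root_.half_pos Q.half_pos⟩

theorem side_bisect (Q : Cube n) (s : Fin n → Bool) : (Q.bisect s).side = Q.side / 2 := by
  simp [side, bisect]; ring

theorem toSet_bisect_subset (Q : Cube n) (s : Fin n → Bool) : (Q.bisect s).toSet ⊆ Q.toSet := by
  have hh := Q.half_pos
  refine closedBall_subset_closedBall' ?_
  have : dist (Q.bisect s).center Q.center ≤ Q.half / 2 := by
    refine (dist_pi_le_iff (by positivity)).2 fun i => ?_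
    simp only [bisect, Real.dist_eq, add_sub_cancel_left]
    rw [abs_le]
    split_ifs <;> constructor <;> linarith
  simp only [bisect] at this ⊢
  linarith

theorem toSet_subset_iUnion_bisect (Q : Cube n) : Q.toSet ⊆ ⋃ s, (Q.bisect s).toSet := by
  intro x hx
  have hh := Q.half_pos
  refine Set.mem_iUnion.2 ⟨fun i => decide (Q.center i ≤ x i), ?_⟩
  refine (dist_pi_le_iff (_root_.half_pos hh).le).2 fun i => ?_
  have hi := (dist_pi_le_iff hh.le).1 hx i
  simp only [bisect, Real.dist_eq, decide_eq_true_eq] at hi ⊢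
  rw [abs_le] at hi ⊢
  split_ifs with h
  · constructor <;> linarith
  · constructor <;> linarith

theorem avgAbs_le_of_bisect (Q : Cube n) {F : (Fin n → ℝ) → ℝ} {M : ℝ} (hM : 0 ≤ M)
    (hF : IntegrableOn F Q.toSet) (H : ∀ s, (Q.bisect s).avgAbs F ≤ M) : Q.avgAbs F ≤ M := by
  refine avgAbs_le_of_lintegral_le hM hF ?_
  have hs := Q.side_pos
  calc ∫⁻ x in Q.toSet, ENNReal.ofReal |F x|
      ≤ ∫⁻ x in ⋃ s, (Q.bisect s).toSet, ENNReal.ofReal |F x| :=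
        lintegral_mono_set Q.toSet_subset_iUnion_bisect
    _ ≤ ∑' s, ∫⁻ x in (Q.bisect s).toSet, ENNReal.ofReal |F x| := lintegral_iUnion_le _ _
    _ ≤ ∑' s : Fin n → Bool, ENNReal.ofReal M * ENNReal.ofReal ((Q.side / 2) ^ n) := by
        gcongr with s
        rw [← side_bisect Q s, ← volume_toSet]
        exact lintegral_le_of_avgAbs_le (hF.mono_set (Q.toSet_bisect_subset s)) (H s)
    _ = ENNReal.ofReal M * volume Q.toSet := by
        rw [tsum_fintype, Finset.sum_const, Finset.card_univ, Fintype.card_fun, Fintype.card_bool,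
          Fintype.card_fin, nsmul_eq_mul, mul_left_comm, volume_toSet,
          ← ENNReal.ofReal_natCast, ← ENNReal.ofReal_mul (by positivity)]
        congr 2
        push_cast
        rw [← mul_pow]
        congr 1
        ring

/-- A bound for the means of `|F|` over subcubes of sidelength in `(t/2, t]` passes to
larger cubes. -/
theorem avgAbs_le_of_small (Q : Cube n) {F : (Fin n → ℝ) → ℝ} {t M : ℝ} (ht : 0 < t) (hM : 0 ≤ M)
    (hF : IntegrableOn F Q.toSet) (hQ : t / 2 < Q.side)
    (H : ∀ P : Cube n, P.toSet ⊆ Q.toSet → t / 2 < P.side → P.side ≤ t → P.avgAbs F ≤ M) :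
    Q.avgAbs F ≤ M := by
  obtain ⟨k, hk⟩ : ∃ k : ℕ, Q.side ≤ 2 ^ k * t := by
    obtain ⟨k, hk⟩ := pow_unbounded_of_one_lt (Q.side / t) one_lt_two
    exact ⟨k, ((div_lt_iff₀ ht).1 hk).le⟩
  induction k generalizing Q with
  | zero => exact H Q subset_rfl hQ (by simpa using hk)
  | succ k ih =>
    rcases le_or_gt Q.side t with h | h
    · exact H Q subset_rfl hQ h
    · refine Q.avgAbs_le_of_bisect hM hF fun s => ?_
      have hsub := Q.toSet_bisect_subset s
      refine ih _ (hF.mono_set hsub) ?_ (fun P hP => H P (hP.trans hsub)) ?_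
      · rw [side_bisect]; linarith
      · rw [side_bisect]; rw [pow_succ] at hk; linarith

end Cube

theorem le_infDist_compl_of_ball_subset {Ω : Set (Fin n → ℝ)} (hc : Ωᶜ.Nonempty)
    {x : Fin n → ℝ} {r : ℝ} (h : ball x r ⊆ Ω) : r ≤ infDist x Ωᶜ :=
  (le_infDist hc).2 fun _ hy => not_lt.1 fun hlt => hy (h (mem_ball'.2 hlt))

theorem closedBall_subset_of_lt_infDist_compl {Ω : Set (Fin n → ℝ)}
    {x : Fin n → ℝ} {r : ℝ} (h : r < infDist x Ωᶜ) : closedBall x r ⊆ Ω :=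
  (closedBall_subset_ball h).trans ball_infDist_compl_subset

theorem infDist_compl_pos {Ω : Set (Fin n → ℝ)} (ho : IsOpen Ω) (hc : Ωᶜ.Nonempty)
    {x : Fin n → ℝ} (hx : x ∈ Ω) : 0 < infDist x Ωᶜ :=
  (ho.isClosed_compl.notMem_iff_infDist_pos hc).1 (fun h => h hx)

theorem abs_infDist_sub_le (s : Set (Fin n → ℝ)) (x y : Fin n → ℝ) :
    |infDist x s - infDist y s| ≤ dist x y := by
  have h1 := infDist_le_infDist_add_dist (s := s) (x := x) (y := y)
  have h2 := infDist_le_infDist_add_dist (s := s) (x := y) (y := x)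
  rw [dist_comm y x] at h2
  rw [abs_le]
  constructor <;> linarith

/-- The distance to the complement of `Ω`, truncated at height `t`. -/
def whitneyScale (Ω : Set (Fin n → ℝ)) (t : ℝ) (x : Fin n → ℝ) : ℝ := min t (infDist x Ωᶜ)

theorem whitneyScale_pos {Ω : Set (Fin n → ℝ)} (ho : IsOpen Ω) (hc : Ωᶜ.Nonempty) {t : ℝ}
    (ht : 0 < t) {x : Fin n → ℝ} (hx : x ∈ Ω) : 0 < whitneyScale Ω t x :=
  lt_min ht (infDist_compl_pos ho hc hx)

theorem abs_whitneyScale_sub_le (Ω : Set (Fin n → ℝ)) (t : ℝ) (x y : Fin n → ℝ) :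
    |whitneyScale Ω t x - whitneyScale Ω t y| ≤ dist x y := by
  refine (abs_min_sub_min_le_max _ _ _ _).trans ?_
  simpa using abs_infDist_sub_le Ωᶜ x y

/-- The mean of `f` over a Whitney cube centered at `x`. -/
def whitneyAvg (Ω : Set (Fin n → ℝ)) (t : ℝ) (f : (Fin n → ℝ) → ℝ) (x : Fin n → ℝ) : ℝ :=
  ⨍ y in closedBall x (whitneyScale Ω t x / 4), f y

theorem whitneyAvg_sub_le {Ω : Set (Fin n → ℝ)} (ho : IsOpen Ω) (hc : Ωᶜ.Nonempty)
    {f : (Fin n → ℝ) → ℝ} (hint : ∀ Q : Cube n, Q.toSet ⊆ Ω → IntegrableOn f Q.toSet)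
    {t η : ℝ} (ht : 0 < t) (hosc : ∀ Q : Cube n, Q.toSet ⊆ Ω → Q.side < 2 * t → Q.osc f ≤ η)
    {x y : Fin n → ℝ} (hx : x ∈ Ω) (hxy : dist x y ≤ whitneyScale Ω t x / 4) :
    |whitneyAvg Ω t f x - whitneyAvg Ω t f y| ≤ 2 * 3 ^ n * η := by
  have hm := whitneyScale_pos ho hc ht hx
  have hmt : whitneyScale Ω t x ≤ t := min_le_left _ _
  have hmd : whitneyScale Ω t x ≤ infDist x Ωᶜ := min_le_right _ _
  have hms := abs_le.1 (abs_whitneyScale_sub_le Ω t x y)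
  set m := whitneyScale Ω t x
  set m' := whitneyScale Ω t y
  let P : Cube n := ⟨x, m / 4, by linarith⟩
  let P' : Cube n := ⟨y, m' / 4, by linarith⟩
  let Q : Cube n := ⟨x, 9 / 16 * m, by linarith⟩
  have hQ : Q.toSet ⊆ Ω := closedBall_subset_of_lt_infDist_compl
    (show 9 / 16 * m < infDist x Ωᶜ by linarith)
  have hPQ : P.toSet ⊆ Q.toSet := closedBall_subset_closedBall (show m / 4 ≤ 9 / 16 * m by linarith)
  have hPQ' : P'.toSet ⊆ Q.toSet :=
    closedBall_subset_closedBall' (show m' / 4 + dist y x ≤ 9 / 16 * m by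
      rw [dist_comm y x]; linarith)
  have h := Cube.abs_avg_sub_avg_le hPQ hPQ' (hint Q hQ) (K := 3)
    (by simp only [Cube.side, P, Q]; linarith) (by simp only [Cube.side, P', Q]; linarith)
  refine h.trans (mul_le_mul_of_nonneg_left (hosc Q hQ ?_) (by positivity))
  simp only [Cube.side, Q]
  linarith

/-- Local-to-global on cubes `Q ⊆ Ω` for functions of small variation on Whitney balls of `Ω`. -/
theorem avgAbs_sub_center_le_of_whitney (hn : 0 < n) {Ω : Set (Fin n → ℝ)} (hc : Ωᶜ.Nonempty)
    {g : (Fin n → ℝ) → ℝ} {t η : ℝ} (hη : 0 ≤ η)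
    (H : ∀ x ∈ Ω, ∀ y, dist x y ≤ whitneyScale Ω t x / 4 → |g x - g y| ≤ η)
    {Q : Cube n} (hg : IntegrableOn g Q.toSet) (hQ : Q.toSet ⊆ Ω) (hs : Q.side ≤ t) :
    Q.avgAbs (fun x => g x - g Q.center) ≤ (12 * n + 1) * η := by
  refine Q.avgAbs_sub_center_le hn hg hη fun x y hx hxy => ?_
  have hh := Q.half_pos
  have hball : ball x (Q.half - dist x Q.center) ⊆ Ω :=
    ((ball_subset_ball' (by linarith)).trans ball_subset_closedBall).trans hQ
  refine H x (hQ hx.le) y (hxy.trans (div_le_div_of_nonneg_right (le_min ?_ ?_) (by norm_num)))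
  · have : Q.side = 2 * Q.half := rfl
    linarith [dist_nonneg (x := x) (y := Q.center)]
  · exact le_infDist_compl_of_ball_subset hc hball

/-- A function vanishing off a closed set `K` that is locally within `η` of a constant is within `η`
of a smooth function vanishing off a prescribed neighborhood of `K`. -/
theorem exists_contDiff_abs_sub_le {v : (Fin n → ℝ) → ℝ} {K K' : Set (Fin n → ℝ)} {η : ℝ}
    (hη : 0 ≤ η) (hK : IsClosed K) (hKK' : K ⊆ interior K') (hv : ∀ x ∉ K, v x = 0)
    (hloc : ∀ x ∈ K, ∀ᶠ y in 𝓝 x, |v x - v y| ≤ η) :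
    ∃ g : (Fin n → ℝ) → ℝ, ContDiff ℝ (⊤ : ℕ∞) g ∧ (∀ x, |g x - v x| ≤ η) ∧ ∀ x ∉ K', g x = 0 := by
  classical
  obtain ⟨g, hg⟩ := exists_contMDiffMap_forall_mem_convex_of_local_const
    (modelWithCornersSelf ℝ (Fin n → ℝ)) (n := (⊤ : ℕ∞))
    (t := fun x => if x ∈ K' then Set.Icc (v x - η) (v x + η) else {0})
    (fun x => by split_ifs; exacts [convex_Icc _ _, convex_singleton _]) (fun x => by
      by_cases hx : x ∈ K
      · refine ⟨v x, ?_⟩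
        filter_upwards [hloc x hx, mem_interior_iff_mem_nhds.1 (hKK' hx)] with y hy hyK
        rw [if_pos hyK]
        rw [abs_le] at hy
        constructor <;> linarith
      · refine ⟨0, ?_⟩
        filter_upwards [hK.isOpen_compl.mem_nhds hx] with y hy
        rw [hv y hy]
        split_ifs
        · constructor <;> linarith
        · rfl)
  refine ⟨g, contMDiff_iff_contDiff.1 g.contMDiff, fun x => ?_, fun x hx => ?_⟩
  · have := hg x
    by_cases hx : x ∈ K'
    · rw [if_pos hx] at this
      rw [abs_le]
      constructor <;> linarith [this.1, this.2]
    · rw [if_neg hx, Set.mem_singleton_iff] at this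
      rw [this, hv x fun h => hx (interior_subset (hKK' h))]
      simpa using hη
  · have := hg x
    rwa [if_neg hx] at this

theorem exists_abs_whitneyAvg_le {Ω : Set (Fin n → ℝ)} (ho : IsOpen Ω) (hc : Ωᶜ.Nonempty)
    {u : (Fin n → ℝ) → ℝ} {t η : ℝ} (ht : 0 < t)
    (H : ∀ x ∈ Ω, ∀ y, dist x y ≤ whitneyScale Ω t x / 4 → |u x - u y| ≤ η)
    {s : ℝ} (hs : 0 < s) (R : ℝ) :
    ∃ N : ℝ, 0 ≤ N ∧ ∀ x, s ≤ infDist x Ωᶜ → ‖x‖ ≤ R → |u x| ≤ N := by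
  have hcpt : IsCompact ({x | s ≤ infDist x Ωᶜ} ∩ closedBall (0 : Fin n → ℝ) R) :=
    (isCompact_closedBall _ _).inter_left
      (isClosed_le continuous_const (continuous_infDist_pt _))
  obtain ⟨N, hN⟩ := hcpt.induction_on (p := fun S => ∃ N : ℝ, ∀ x ∈ S, |u x| ≤ N)
    ⟨0, by simp⟩ (fun S T hST ⟨N, hN⟩ => ⟨N, fun x hx => hN x (hST hx)⟩)
    (fun S T ⟨N, hN⟩ ⟨M, hM⟩ => ⟨max N M, fun x hx => hx.elim
      (fun h => (hN x h).trans (le_max_left _ _)) (fun h => (hM x h).trans (le_max_right _ _))⟩)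
    (fun x hx => by
      have hxΩ : x ∈ Ω := by
        by_contra h
        have h1 : s ≤ infDist x Ωᶜ := hx.1
        rw [infDist_zero_of_mem h] at h1
        linarith
      refine ⟨closedBall x (whitneyScale Ω t x / 4), mem_nhdsWithin_of_mem_nhds
        (closedBall_mem_nhds _ (by linarith [whitneyScale_pos ho hc ht hxΩ])),
        |u x| + η, fun y hy => ?_⟩
      have h1 := H x hxΩ y (mem_closedBall'.1 hy)
      have h2 := abs_sub_abs_le_abs_sub (u y) (u x)
      rw [abs_sub_comm] at h1
      linarith)
  refine ⟨max N 0, le_max_right _ _, fun x h1 h2 => (hN x ⟨h1, ?_⟩).trans (le_max_left _ _)⟩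
  simpa using h2

theorem abs_log_sub_log_le {a b : ℝ} (ha : 0 < a) (h : |a - b| ≤ a / 4) :
    |Real.log a - Real.log b| ≤ 1 := by
  rw [abs_le] at h
  have hb : 0 < b := by linarith
  rw [abs_le, ← Real.log_div ha.ne' hb.ne']
  have h1 := Real.log_le_sub_one_of_pos (div_pos ha hb)
  have h2 := Real.log_le_sub_one_of_pos (div_pos hb ha)
  rw [← inv_div, Real.log_inv] at h2
  rw [inv_div] at h2
  have h3 : a / b ≤ 2 := (div_le_iff₀ hb).2 (by linarith)
  have h4 : b / a ≤ 2 := (div_le_iff₀ ha).2 (by linarith)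
  constructor <;> linarith

/-- A logarithmic cutoff height: at least `N` where `s ≤ d_Ω` and `‖x‖ ≤ R`, zero off a
compact subset of `Ω`. -/
def cutoffHeight (Ω : Set (Fin n → ℝ)) (t η s R N : ℝ) (x : Fin n → ℝ) : ℝ :=
  max 0 (min (N + η * (Real.log (infDist x Ωᶜ) - Real.log s)) (N + η * ((R - ‖x‖) / t)))

theorem cutoffHeight_sub_le {Ω : Set (Fin n → ℝ)} (ho : IsOpen Ω) (hc : Ωᶜ.Nonempty)
    {t η : ℝ} (ht : 0 < t) (hη : 0 ≤ η) (s R N : ℝ) {x y : Fin n → ℝ} (hx : x ∈ Ω)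
    (hxy : dist x y ≤ whitneyScale Ω t x / 4) :
    |cutoffHeight Ω t η s R N x - cutoffHeight Ω t η s R N y| ≤ η := by
  have hmt : whitneyScale Ω t x ≤ t := min_le_left _ _
  have hmd : whitneyScale Ω t x ≤ infDist x Ωᶜ := min_le_right _ _
  have hd := infDist_compl_pos ho hc hx
  refine (abs_max_sub_max_le_max _ _ _ _).trans (max_le (by simpa using hη) ?_)
  refine (abs_min_sub_min_le_max _ _ _ _).trans (max_le ?_ ?_)
  · have h := abs_log_sub_log_le hd ((abs_infDist_sub_le Ωᶜ x y).trans (by linarith))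
    rw [show N + η * (Real.log (infDist x Ωᶜ) - Real.log s) -
      (N + η * (Real.log (infDist y Ωᶜ) - Real.log s)) =
      η * (Real.log (infDist x Ωᶜ) - Real.log (infDist y Ωᶜ)) by ring, abs_mul, abs_of_nonneg hη]
    exact mul_le_of_le_one_right hη h
  · have h : |‖y‖ - ‖x‖| ≤ t := by
      have := abs_norm_sub_norm_le y x
      rw [← dist_eq_norm, dist_comm] at this
      linarith
    rw [show N + η * ((R - ‖x‖) / t) - (N + η * ((R - ‖y‖) / t)) = η * ((‖y‖ - ‖x‖) / t) by ring,
      abs_mul, abs_of_nonneg hη, abs_div, abs_of_pos ht]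
    exact mul_le_of_le_one_right hη ((div_le_one ht).2 h)

/-- The constant in the approximation by smooth compactly supported functions. -/
def approxConst (n : ℕ) : ℝ := 3 + 8 ^ n + 2 * 3 ^ n + 3 * ((12 * n + 1) * (3 * (2 * 3 ^ n)))

theorem approxConst_pos (n : ℕ) : 0 < approxConst n := by unfold approxConst; positivity

theorem abs_truncate_sub_le {a b A B M : ℝ} (h : |a - b| ≤ M) (hAB : |A - B| ≤ M) :
    |max (-A) (min a A) - max (-B) (min b B)| ≤ M := by
  refine (abs_max_sub_max_le_max _ _ _ _).trans (max_le ?_ ?_)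
  · rwa [neg_sub_neg, abs_sub_comm]
  · exact (abs_min_sub_min_le_max _ _ _ _).trans (max_le h hAB)

theorem truncate_eq_self {a A : ℝ} (h : |a| ≤ A) : max (-A) (min a A) = a := by
  rw [abs_le] at h
  rw [min_eq_left h.2, max_eq_right h.1]

theorem abs_truncate_le {a A : ℝ} (hA : 0 ≤ A) : |max (-A) (min a A)| ≤ |a| := by
  rcases le_total |a| A with h | h
  · rw [truncate_eq_self h]
  · refine le_trans (abs_le.2 ⟨le_max_left _ _, ?_⟩) h
    exact max_le (by linarith) (min_le_right _ _)

/-- A compactly supported smooth function following the Whitney averages `u` of `f` wherever these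
are not too close to the boundary. -/
theorem exists_contDiff_near_whitneyAvg {Ω : Set (Fin n → ℝ)} (ho : IsOpen Ω) (hc : Ωᶜ.Nonempty)
    {u : (Fin n → ℝ) → ℝ} {t η η' s : ℝ} (ht : 0 < t) (hη : 0 < η) (hηη' : η ≤ η') (hs : 0 < s)
    (H : ∀ x ∈ Ω, ∀ y, dist x y ≤ whitneyScale Ω t x / 4 → |u x - u y| ≤ η')
    (hinf : ∃ R, ∀ x ∈ Ω, s ≤ infDist x Ωᶜ → R ≤ ‖x‖ → |u x| ≤ η) :
    ∃ g : (Fin n → ℝ) → ℝ, ContDiff ℝ (⊤ : ℕ∞) g ∧ HasCompactSupport g ∧ tsupport g ⊆ Ω ∧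
      (∀ x ∈ Ω, ∀ y, dist x y ≤ whitneyScale Ω t x / 4 → |g x - g y| ≤ 3 * η') ∧
      ∀ x ∈ Ω, s ≤ infDist x Ωᶜ → |u x - g x| ≤ 2 * η + η' := by
  classical
  obtain ⟨R, hR⟩ := hinf
  obtain ⟨N, hN0, hN⟩ := exists_abs_whitneyAvg_le ho hc ht H hs R
  have hη' : 0 < η' := hη.trans_le hηη'
  set A : (Fin n → ℝ) → ℝ := cutoffHeight Ω t η s R N with hA
  have hA0 : ∀ x, 0 ≤ A x := fun x => le_max_left _ _
  set v : (Fin n → ℝ) → ℝ := fun x => if x ∈ Ω then max (-(A x)) (min (u x) (A x)) else 0 with hv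
  have hvH : ∀ x ∈ Ω, ∀ y, dist x y ≤ whitneyScale Ω t x / 4 → |v x - v y| ≤ η' := by
    intro x hx y hxy
    have hy : y ∈ Ω := by
      have hd := infDist_compl_pos ho hc hx
      have hmd : whitneyScale Ω t x ≤ infDist x Ωᶜ := min_le_right _ _
      exact ball_infDist_compl_subset (mem_ball'.2 (by linarith))
    simp only [hv, if_pos hx, if_pos hy]
    exact abs_truncate_sub_le (H x hx y hxy)
      ((cutoffHeight_sub_le ho hc ht hη.le s R N hx hxy).trans hηη')
  set a : ℝ := Real.exp (Real.log s - N / η) with ha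
  have ha0 : 0 < a := Real.exp_pos _
  set K : Set (Fin n → ℝ) := {x | a ≤ infDist x Ωᶜ} ∩ closedBall 0 (R + t * (N / η)) with hK
  set K' : Set (Fin n → ℝ) := {x | a / 2 ≤ infDist x Ωᶜ} ∩ closedBall 0 (R + t * (N / η) + 1)
    with hK'
  have hmemΩ : ∀ x, 0 < infDist x Ωᶜ → x ∈ Ω := fun x hx => by
    by_contra h
    rw [infDist_zero_of_mem h] at hx
    exact lt_irrefl _ hx
  have hK'Ω : K' ⊆ Ω := fun x hx => hmemΩ x (lt_of_lt_of_le (by positivity) hx.1)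
  have hKc : IsClosed K := (isClosed_le continuous_const (continuous_infDist_pt _)).inter
    isClosed_closedBall
  have hK'c : IsCompact K' := (isCompact_closedBall _ _).inter_left
    (isClosed_le continuous_const (continuous_infDist_pt _))
  have hKK' : K ⊆ interior K' := by
    have hU : IsOpen ({x | a / 2 < infDist x Ωᶜ} ∩ ball (0 : Fin n → ℝ) (R + t * (N / η) + 1)) :=
      (isOpen_lt continuous_const (continuous_infDist_pt _)).inter isOpen_ball
    have hUK : {x | a / 2 < infDist x Ωᶜ} ∩ ball (0 : Fin n → ℝ) (R + t * (N / η) + 1) ⊆ K' :=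
      fun y hy => ⟨show a / 2 ≤ infDist y Ωᶜ from le_of_lt hy.1, ball_subset_closedBall hy.2⟩
    intro x hx
    refine interior_maximal hUK hU ⟨?_, closedBall_subset_ball (by linarith) hx.2⟩
    have : a ≤ infDist x Ωᶜ := hx.1
    exact lt_of_lt_of_le (by linarith) this
  have hvK : ∀ x ∉ K, v x = 0 := by
    intro x hx
    by_cases hxΩ : x ∈ Ω
    · have hA' : A x = 0 := by
        refine max_eq_left ?_
        have hd := infDist_compl_pos ho hc hxΩ
        by_cases h : a ≤ infDist x Ωᶜ
        · refine (min_le_right _ _).trans ?_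
          have h2 : R + t * (N / η) < ‖x‖ := by
            by_contra h2
            exact hx ⟨h, by simpa using h2⟩
          have h3 : (R - ‖x‖) / t ≤ -(N / η) := (div_le_iff₀ ht).2 (by linarith)
          have h4 := mul_le_mul_of_nonneg_left h3 hη.le
          rw [mul_neg, mul_div_cancel₀ _ hη.ne'] at h4
          linarith
        · refine (min_le_left _ _).trans ?_
          have h2 := Real.log_lt_log hd (not_le.1 h)
          rw [ha, Real.log_exp] at h2
          have h3 : Real.log (infDist x Ωᶜ) - Real.log s ≤ -(N / η) := by linarith
          have h4 := mul_le_mul_of_nonneg_left h3 hη.le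
          rw [mul_neg, mul_div_cancel₀ _ hη.ne'] at h4
          linarith
      simp only [hv, if_pos hxΩ, hA', neg_zero]
      exact max_eq_left (min_le_right _ _)
    · simp only [hv, if_neg hxΩ]
  have hloc : ∀ x ∈ K, ∀ᶠ y in 𝓝 x, |v x - v y| ≤ η' := fun x hx => by
    have hxΩ := hK'Ω (interior_subset (hKK' hx))
    filter_upwards [closedBall_mem_nhds x (ε := whitneyScale Ω t x / 4)
      (by linarith [whitneyScale_pos ho hc ht hxΩ])] with y hy
    exact hvH x hxΩ y (mem_closedBall'.1 hy)
  obtain ⟨g, hgs, hgv, hg0⟩ := exists_contDiff_abs_sub_le hη'.le hKc hKK' hvK hloc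
  refine ⟨g, hgs, HasCompactSupport.intro hK'c hg0, ?_, ?_, ?_⟩
  · refine (closure_minimal (fun x hx => ?_) hK'c.isClosed).trans hK'Ω
    by_contra h
    exact hx (hg0 x h)
  · intro x hx y hxy
    have h1 := abs_le.1 (hgv x)
    have h2 := abs_le.1 (hgv y)
    have h3 := abs_le.1 (hvH x hx y hxy)
    rw [abs_le]
    constructor <;> linarith
  · intro x hx hxs
    have h1 := abs_le.1 (hgv x)
    have h2 : |u x - v x| ≤ 2 * η := by
      simp only [hv, if_pos hx]
      rcases le_total ‖x‖ R with h | h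
      · rw [truncate_eq_self]
        · simpa using hη.le
        · refine (hN x hxs h).trans (le_max_of_le_right (le_min ?_ ?_))
          · have := Real.log_le_log hs hxs
            nlinarith
          · have : 0 ≤ (R - ‖x‖) / t := div_nonneg (by linarith) ht.le
            nlinarith
      · have h3 := hR x hx hxs h
        have h4 := abs_sub (u x) (max (-(A x)) (min (u x) (A x)))
        have h5 := abs_truncate_le (a := u x) (hA0 x)
        linarith
    rw [abs_le] at h2 ⊢
    constructor <;> linarith

theorem exists_contDiff_approx (hn : 0 < n) {Ω : Set (Fin n → ℝ)} (ho : IsOpen Ω)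
    (hc : Ωᶜ.Nonempty) {f : (Fin n → ℝ) → ℝ}
    (hint : ∀ Q : Cube n, Q.toSet ⊆ Ω → IntegrableOn f Q.toSet)
    {t η : ℝ} (ht : 0 < t) (hη : 0 < η)
    (hosc : ∀ Q : Cube n, Q.toSet ⊆ Ω → Q.side < 2 * t → Q.osc f ≤ η)
    (hinf : ∃ R, ∀ x ∈ Ω, t / 4 ≤ infDist x Ωᶜ → R ≤ ‖x‖ → |whitneyAvg Ω t f x| ≤ η) :
    ∃ g : (Fin n → ℝ) → ℝ, ContDiff ℝ (⊤ : ℕ∞) g ∧ HasCompactSupport g ∧ tsupport g ⊆ Ω ∧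
      (∀ Q : Cube n, Q.toSet ⊆ Ω → Q.side ≤ t → Q.osc (f - g) ≤ approxConst n * η) ∧
      ∀ Q : Cube n, Q.toSet ⊆ Ω → t ≤ Q.side → Q.avgAbs (f - g) ≤ approxConst n * η := by
  have h3 : (1 : ℝ) ≤ 3 ^ n := one_le_pow₀ (by norm_num)
  set η' : ℝ := 2 * 3 ^ n * η with hη'
  have hηη' : η ≤ η' := by nlinarith
  obtain ⟨g, hgs, hgc, hgΩ, hgH, hug⟩ := exists_contDiff_near_whitneyAvg ho hc ht hη hηη'
    (show 0 < t / 4 by linarith) (fun x hx y hxy => whitneyAvg_sub_le ho hc hint ht hosc hx hxy) hinf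
  have hgi : ∀ Q : Cube n, IntegrableOn g Q.toSet := fun Q =>
    hgs.continuous.continuousOn.integrableOn_compact Q.isCompact_toSet
  set L : ℝ := (12 * n + 1) * (3 * η') with hL
  have hCη : approxConst n * η = 3 * η + 8 ^ n * η + η' + 3 * L := by
    rw [approxConst, hL, hη']; ring
  have hL0 : 0 ≤ L := by positivity
  have h8 : 0 ≤ 8 ^ n * η := by positivity
  have hgQ : ∀ Q : Cube n, Q.toSet ⊆ Ω → Q.side ≤ t →
      Q.avgAbs (fun x => g x - g Q.center) ≤ L := fun Q hQ hs =>
    avgAbs_sub_center_le_of_whitney hn hc (by positivity) hgH (hgi Q) hQ hs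
  have hsmall : ∀ Q : Cube n, Q.toSet ⊆ Ω → Q.side ≤ t → Q.osc (f - g) ≤ η + 2 * L := by
    intro Q hQ hs
    have h1 := Q.osc_sub_le (hint Q hQ) (hgi Q)
    have h2 := Q.osc_le_two_mul (hgi Q) (g Q.center)
    have h3 := hosc Q hQ (by linarith)
    have h4 := hgQ Q hQ hs
    linarith
  refine ⟨g, hgs, hgc, hgΩ, fun Q hQ hs => (hsmall Q hQ hs).trans (by linarith), fun Q hQ hs => ?_⟩
  refine Q.avgAbs_le_of_small ht (mul_pos (approxConst_pos n) hη).le ((hint Q hQ).sub (hgi Q))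
    (by linarith) fun P hPQ hPt hPt' => ?_
  have hPΩ := hPQ.trans hQ
  have hfP := hint P hPΩ
  have hside : P.side = 2 * P.half := rfl
  have hcΩ : P.center ∈ Ω := hPΩ (mem_closedBall_self P.half_pos.le)
  have hcd : P.half ≤ infDist P.center Ωᶜ :=
    le_infDist_compl_of_ball_subset hc (ball_subset_closedBall.trans hPΩ)
  have hm : t / 4 ≤ whitneyScale Ω t P.center := le_min (by linarith) (by linarith)
  have hmt : whitneyScale Ω t P.center ≤ t := min_le_left _ _
  let W : Cube n := ⟨P.center, whitneyScale Ω t P.center / 4, by linarith⟩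
  have hWP : W.toSet ⊆ P.toSet :=
    closedBall_subset_closedBall (show whitneyScale Ω t P.center / 4 ≤ P.half by linarith)
  have hWs : W.side = 2 * (whitneyScale Ω t P.center / 4) := rfl
  have hu : |whitneyAvg Ω t f P.center - P.avg f| ≤ 8 ^ n * η := by
    refine (Cube.abs_avg_sub_avg_le_osc hWP hfP).trans ?_
    refine mul_le_mul (pow_le_pow_left₀ (div_nonneg P.side_pos.le W.side_pos.le) ?_ n)
      (hosc P hPΩ (by linarith)) (P.osc_nonneg f) (by positivity)
    rw [div_le_iff₀ W.side_pos]
    linarith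
  have hgc' := (P.abs_avg_sub_le_self (hgi P) (g P.center)).trans (hgQ P hPΩ hPt')
  have hugc := hug P.center hcΩ (by linarith)
  have hav : |P.avg (f - g)| ≤ 8 ^ n * η + (2 * η + η') + L := by
    rw [P.avg_sub hfP (hgi P)]
    rw [abs_le] at hu hgc' hugc ⊢
    constructor <;> linarith
  have h1 := P.avgAbs_le_osc_add (hfP.sub (hgi P))
  have h2 := hsmall P hPΩ hPt'
  linarith

/-- A function varying by at most `M` between points of a curve at distance at most `ρ` varies
by at most `(k + 1) * M` along the curve if the curve has length at most `k * ρ`. -/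
theorem abs_sub_le_of_eVariationOn_le {γ : ℝ → Fin n → ℝ} {F : (Fin n → ℝ) → ℝ} {ρ M b : ℝ}
    (hρ : 0 < ρ) (hM : 0 ≤ M) (k : ℕ) {a : ℝ} (hab : a ≤ b) (hγ : ContinuousOn γ (Set.Icc a b))
    (hlen : eVariationOn γ (Set.Icc a b) ≤ ENNReal.ofReal (k * ρ))
    (hF : ∀ s ∈ Set.Icc a b, ∀ s' ∈ Set.Icc a b, dist (γ s) (γ s') ≤ ρ →
      |F (γ s) - F (γ s')| ≤ M) :
    |F (γ a) - F (γ b)| ≤ (k + 1) * M := by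
  induction k generalizing a with
  | zero =>
    have h1 := (eVariationOn.edist_le γ (Set.left_mem_Icc.2 hab) (Set.right_mem_Icc.2 hab)).trans
      hlen
    have h2 : dist (γ a) (γ b) ≤ ρ := by
      rw [edist_dist, ENNReal.ofReal_le_ofReal_iff (by simp)] at h1
      simpa using h1.trans (by simpa using hρ.le)
    simpa using hF a (Set.left_mem_Icc.2 hab) b (Set.right_mem_Icc.2 hab) h2
  | succ k ih =>
    rcases le_or_gt (dist (γ a) (γ b)) ρ with h | h
    · have h1 := hF a (Set.left_mem_Icc.2 hab) b (Set.right_mem_Icc.2 hab) h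
      refine h1.trans (le_mul_of_one_le_left hM ?_)
      linarith [Nat.cast_nonneg (α := ℝ) (k + 1)]
    · have hcd : ContinuousOn (fun s => dist (γ a) (γ s)) (Set.Icc a b) :=
        (continuous_const.dist continuous_id).comp_continuousOn hγ
      obtain ⟨c, hc, hcρ⟩ := intermediate_value_Icc hab hcd
        (show ρ ∈ Set.Icc _ _ from ⟨by simpa using hρ.le, h.le⟩)
      have hsub : Set.Icc c b ⊆ Set.Icc a b := Set.Icc_subset_Icc_left hc.1
      have hadd := eVariationOn.Icc_add_Icc γ (s := Set.univ) hc.1 hc.2 (Set.mem_univ c)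
      simp only [Set.univ_inter] at hadd
      have h1 := eVariationOn.edist_le γ (s := Set.Icc a c) (Set.left_mem_Icc.2 hc.1)
        (Set.right_mem_Icc.2 hc.1)
      have hlen' : eVariationOn γ (Set.Icc c b) ≤ ENNReal.ofReal (k * ρ) := by
        simp only at hcρ
        rw [edist_dist, hcρ] at h1
        have h2 : ENNReal.ofReal ρ + eVariationOn γ (Set.Icc c b) ≤
            ENNReal.ofReal ρ + ENNReal.ofReal (k * ρ) := by
          rw [← ENNReal.ofReal_add hρ.le (by positivity)]
          calc _ ≤ _ := add_le_add_left h1 _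
            _ = _ := hadd
            _ ≤ _ := hlen
            _ = _ := by congr 1; push_cast; ring
        exact (ENNReal.add_le_add_iff_left ENNReal.ofReal_ne_top).1 h2
      have h2 := ih hc.2 (hγ.mono hsub) hlen'
        (fun s hs s' hs' => hF s (hsub hs) s' (hsub hs'))
      have h3 := hF a (Set.left_mem_Icc.2 hab) c hc hcρ.le
      have h4 := abs_sub_le (F (γ a)) (F (γ c)) (F (γ b))
      push_cast
      linarith

theorem infDist_frontier_le_infDist_compl {Ω : Set (Fin n → ℝ)} (hc : Ωᶜ.Nonempty)
    {x : Fin n → ℝ} (hx : x ∈ Ω) : infDist x (frontier Ω) ≤ infDist x Ωᶜ := by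
  obtain ⟨y, hy, hxy⟩ := exists_mem_frontier_infDist_compl_eq_dist hx
    (Set.nonempty_compl.1 hc)
  rw [hxy]
  exact infDist_le_dist_of_mem hy

/-- In an (ε,δ)-domain, an initial piece of the curve from `x` to a point at distance `δ/2`
stays away from the boundary and ends at a point at distance at least `εδ/8` from it. -/
theorem IsEpsDeltaDomain.exists_curve {Ω : Set (Fin n → ℝ)} {ε δ : ℝ}
    (hed : IsEpsDeltaDomain Ω ε δ) (hε : 0 < ε) (hδ : 0 < δ)
    {x y : Fin n → ℝ} (hx : x ∈ Ω) (hy : y ∈ Ω) (hxy : dist x y = δ / 2) :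
    ∃ γ : ℝ → Fin n → ℝ, ∃ τ : ℝ, 0 ≤ τ ∧ ContinuousOn γ (Set.Icc 0 τ) ∧ γ 0 = x ∧
      eVariationOn γ (Set.Icc 0 τ) ≤ ENNReal.ofReal (ε⁻¹ * (δ / 2)) ∧
      (∀ s ∈ Set.Icc 0 τ, γ s ∈ Ω ∧ dist (γ s) x ≤ δ / 4 ∧
        ε * dist (γ s) x / 2 ≤ infDist (γ s) (frontier Ω)) ∧ dist (γ τ) x = δ / 4 := by
  obtain ⟨γ, hγ, h0, h1, hΩ, hlen, hcig⟩ := hed x hx y hy (by rw [hxy]; linarith)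
  have hcd : ContinuousOn (fun s => dist (γ s) x) (Set.Icc 0 1) :=
    (continuous_id.dist continuous_const).comp_continuousOn hγ
  have hcpt : IsCompact (Set.Icc (0 : ℝ) 1 ∩ (fun s => dist (γ s) x) ⁻¹' {δ / 4}) :=
    isCompact_Icc.of_isClosed_subset
      (hcd.preimage_isClosed_of_isClosed isClosed_Icc isClosed_singleton) Set.inter_subset_left
  have hivt : ∀ b ∈ Set.Icc (0 : ℝ) 1, δ / 4 ≤ dist (γ b) x →
      ∃ s ∈ Set.Icc 0 b, dist (γ s) x = δ / 4 := fun b hb hbd =>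
    intermediate_value_Icc hb.1 (hcd.mono (Set.Icc_subset_Icc_right hb.2))
      ⟨by simp [h0]; linarith, hbd⟩
  obtain ⟨s₀, hs₀, hs₀'⟩ := hivt 1 (by simp) (by rw [h1, dist_comm, hxy]; linarith)
  obtain ⟨τ, ⟨hτ, hτd⟩, hmin⟩ := hcpt.exists_isLeast ⟨s₀, hs₀, hs₀'⟩
  have hsub : Set.Icc 0 τ ⊆ Set.Icc (0 : ℝ) 1 := Set.Icc_subset_Icc_right hτ.2
  refine ⟨γ, τ, hτ.1, hγ.mono hsub, h0, ?_, fun s hs => ?_, hτd⟩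
  · rw [← hxy]
    exact (eVariationOn.mono γ hsub).trans hlen
  · have hle : dist (γ s) x ≤ δ / 4 := by
      by_contra! h
      obtain ⟨r, hr, hr'⟩ := hivt s (hsub hs) h.le
      have h2 : τ ≤ r := hmin ⟨⟨hr.1, hr.2.trans (hsub hs).2⟩, hr'⟩
      have h3 : s = τ := le_antisymm hs.2 (h2.trans hr.2)
      rw [h3] at h
      exact h.ne' hτd
    refine ⟨hΩ s (hsub hs), hle, le_trans ?_ (hcig s (hsub hs))⟩
    have h2 := dist_triangle_left x y (γ s)
    rw [hxy] at h2 ⊢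
    have h3 : δ / 4 ≤ dist (γ s) y := by linarith
    rw [le_div_iff₀ (by linarith)]
    have h4 : 0 ≤ ε * dist (γ s) x := by positivity
    nlinarith

theorem exists_mem_dist_eq {Ω : Set (Fin n → ℝ)} (hΩ : IsPreconnected Ω) {x z : Fin n → ℝ} {r : ℝ}
    (hx : x ∈ Ω) (hz : z ∈ Ω) (hr : 0 ≤ r) (hxz : r ≤ dist x z) : ∃ y ∈ Ω, dist x y = r :=
  hΩ.intermediate_value hx hz (f := fun y => dist x y)
    (continuous_const.dist continuous_id).continuousOn ⟨by simpa using hr, hxz⟩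

theorem IsEpsDeltaDomain.compl_nonempty (hn : 0 < n) {Ω : Set (Fin n → ℝ)} {ε δ : ℝ}
    (hed : IsEpsDeltaDomain Ω ε δ) (hε : 0 < ε) (hδ : 0 < δ) : Ωᶜ.Nonempty := by
  by_contra h
  have hu : Ω = Set.univ := Set.compl_empty_iff.1 (Set.not_nonempty_iff_eq_empty.1 h)
  subst hu
  have : Nonempty (Fin n) := ⟨⟨0, hn⟩⟩
  obtain ⟨γ, τ, hτ, -, -, -, hs, hτd⟩ := hed.exists_curve hε hδ (x := 0)
    (y := fun _ => δ / 2) trivial trivial (by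
      rw [dist_comm, dist_zero_right, pi_norm_const, Real.norm_of_nonneg (by linarith)])
  have h1 := (hs τ ⟨hτ, le_rfl⟩).2.2
  rw [hτd, frontier_univ, infDist_empty] at h1
  have : 0 < ε * (δ / 4) / 2 := by positivity
  linarith

/-- If `f` vanishes at infinity in an (ε,δ)-domain, then so do its means over Whitney cubes
whose sidelength is bounded below. -/
theorem IsEpsDeltaDomain.exists_abs_whitneyAvg_le {Ω : Set (Fin n → ℝ)} {ε δ : ℝ} (hn : 0 < n)
    (hed : IsEpsDeltaDomain Ω ε δ) (hε : 0 < ε) (hε1 : ε ≤ 1) (hδ : 0 < δ)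
    (hconn : IsPreconnected Ω) {f : (Fin n → ℝ) → ℝ}
    (hint : ∀ Q : Cube n, Q.toSet ⊆ Ω → IntegrableOn f Q.toSet)
    {t lam : ℝ} (ht : 0 < t) (htl : 2 * t < lam) (hlam : lam < ε * δ / 4)
    (hvan : ∀ θ > 0, ∃ R : ℝ, ∀ Q : Cube n, Q.toSet ⊆ Ω \ closedBall 0 R →
      (Q.side < lam → Q.osc f ≤ θ) ∧ (lam ≤ Q.side → Q.avgAbs f ≤ θ))
    {η : ℝ} (hη : 0 < η) :
    ∃ R, ∀ x ∈ Ω, t / 4 ≤ infDist x Ωᶜ → R ≤ ‖x‖ → |whitneyAvg Ω t f x| ≤ η := by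
  by_cases hb : Bornology.IsBounded Ω
  · obtain ⟨R, hR⟩ := hb.subset_ball (0 : Fin n → ℝ)
    exact ⟨R, fun x hx _ hxR => absurd (mem_ball_zero_iff.1 (hR hx)) hxR.not_gt⟩
  have hc := hed.compl_nonempty hn hε hδ
  have hεt : ε * t ≤ t := by nlinarith
  have hεt0 : 0 < ε * t := mul_pos hε ht
  obtain ⟨ρ, hρ⟩ : ∃ ρ, ρ = ε * t / 64 := ⟨_, rfl⟩
  have hρ0 : 0 < ρ := by rw [hρ]; positivity
  set k := ⌈ε⁻¹ * (δ / 2) / ρ⌉₊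
  have hk : ε⁻¹ * (δ / 2) ≤ k * ρ := (div_le_iff₀ hρ0).1 (Nat.le_ceil _)
  set C : ℝ := (t / 2 / (2 * ρ)) ^ n + (k + 1) * (2 * 2 ^ n) + (lam / (2 * ρ)) ^ n with hC
  have hl0 : 0 < lam := by linarith
  have hC0 : 0 < C := by positivity
  set θ := η / C with hθ
  have hθ0 : 0 < θ := div_pos hη hC0
  obtain ⟨R, hR⟩ := hvan θ hθ0
  refine ⟨R + δ + lam, fun x hx hxd hxR => ?_⟩
  obtain ⟨w, hw, hxw⟩ : ∃ w ∈ Ω, δ / 2 ≤ dist x w := by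
    by_contra! h
    exact hb (isBounded_ball.subset fun w hw => mem_ball'.2 (h w hw))
  obtain ⟨y, hy, hxy⟩ := exists_mem_dist_eq hconn hx hw (by positivity) hxw
  obtain ⟨γ, τ, hτ, hγ, h0, hlen, hcig, hend⟩ := hed.exists_curve hε hδ hx hy hxy
  have hout : ∀ Q : Cube n, dist Q.center x ≤ δ / 4 → Q.half ≤ lam →
      Q.half < infDist Q.center Ωᶜ → Q.toSet ⊆ Ω \ closedBall 0 R := fun Q h1 h2 h3 u hu => by
    refine ⟨closedBall_subset_of_lt_infDist_compl h3 hu, fun h4 => ?_⟩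
    have h5 : dist u Q.center ≤ Q.half := hu
    rw [mem_closedBall] at h4
    rw [← dist_zero_right] at hxR
    have h7 := dist_triangle x Q.center 0
    have h8 := dist_triangle Q.center u 0
    rw [dist_comm x Q.center] at h7
    rw [dist_comm Q.center u] at h8
    linarith
  have hdist : ∀ s ∈ Set.Icc 0 τ, 4 * ρ ≤ infDist (γ s) Ωᶜ := fun s hs => by
    obtain ⟨h1, -, h3⟩ := hcig s hs
    rcases le_or_gt (dist (γ s) x) (t / 8) with h | h
    · have := infDist_le_infDist_add_dist (s := Ωᶜ) (x := x) (y := γ s)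
      rw [dist_comm] at this
      linarith
    · have := infDist_frontier_le_infDist_compl hc h1
      have : ε * (t / 8) ≤ ε * dist (γ s) x := mul_le_mul_of_nonneg_left h.le hε.le
      linarith
  let F : (Fin n → ℝ) → ℝ := fun p => Cube.avg ⟨p, ρ, hρ0⟩ f
  have hchain : |F (γ 0) - F (γ τ)| ≤ (k + 1) * (2 * 2 ^ n * θ) := by
    refine abs_sub_le_of_eVariationOn_le hρ0 (by positivity) k hτ hγ
      (hlen.trans (ENNReal.ofReal_le_ofReal hk)) fun s hs s' hs' hss => ?_
    let Q : Cube n := ⟨γ s, 2 * ρ, by positivity⟩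
    have hQ : Q.toSet ⊆ Ω \ closedBall 0 R := hout Q (hcig s hs).2.1
      (show 2 * ρ ≤ lam by linarith) (show 2 * ρ < _ by linarith [hdist s hs])
    have h1 : (⟨γ s, ρ, hρ0⟩ : Cube n).toSet ⊆ Q.toSet :=
      closedBall_subset_closedBall (by linarith)
    have h2 : (⟨γ s', ρ, hρ0⟩ : Cube n).toSet ⊆ Q.toSet :=
      closedBall_subset_closedBall' (by rw [dist_comm]; linarith)
    refine (Cube.abs_avg_sub_avg_le h1 h2 (hint Q (hQ.trans Set.sdiff_subset)) (K := 2)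
      (by simp only [Cube.side, Q]; linarith) (by simp only [Cube.side, Q]; linarith)).trans ?_
    refine mul_le_mul_of_nonneg_left ((hR Q hQ).1 ?_) (by positivity)
    simp only [Cube.side, Q]
    linarith
  have hfinal : |F (γ τ)| ≤ (lam / (2 * ρ)) ^ n * θ := by
    obtain ⟨h1, h2, h3⟩ := hcig τ ⟨hτ, le_rfl⟩
    have h4 := infDist_frontier_le_infDist_compl hc h1
    rw [hend] at h3
    let Q : Cube n := ⟨γ τ, lam / 2, by positivity⟩
    have hs : Q.side = lam := by simp only [Cube.side, Q]; ring
    have hQ : Q.toSet ⊆ Ω \ closedBall 0 R := hout Q h2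
      (show lam / 2 ≤ lam by linarith) (show lam / 2 < _ by linarith)
    have h5 : (⟨γ τ, ρ, hρ0⟩ : Cube n).toSet ⊆ Q.toSet :=
      closedBall_subset_closedBall (show ρ ≤ lam / 2 by linarith)
    have h6 := Cube.abs_avg_le_avgAbs h5 (hint Q (hQ.trans Set.sdiff_subset))
    rw [hs, show Cube.side ⟨_, ρ, hρ0⟩ = 2 * ρ from rfl] at h6
    exact h6.trans (mul_le_mul_of_nonneg_left ((hR Q hQ).2 hs.ge) (by positivity))
  have hinit : |F x - whitneyAvg Ω t f x| ≤ (t / 2 / (2 * ρ)) ^ n * θ := by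
    have hm1 : t / 4 ≤ whitneyScale Ω t x := le_min (by linarith) hxd
    have hm2 : whitneyScale Ω t x ≤ t := min_le_left _ _
    have hm3 : whitneyScale Ω t x ≤ infDist x Ωᶜ := min_le_right _ _
    let Q : Cube n := ⟨x, whitneyScale Ω t x / 4, by linarith⟩
    have hs : Q.side = whitneyScale Ω t x / 2 := by simp only [Cube.side, Q]; ring
    have hQ : Q.toSet ⊆ Ω \ closedBall 0 R := hout Q (by simpa [Q] using by positivity)
      (show whitneyScale Ω t x / 4 ≤ lam by linarith)
      (show whitneyScale Ω t x / 4 < infDist x Ωᶜ by linarith)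
    have h5 : (⟨x, ρ, hρ0⟩ : Cube n).toSet ⊆ Q.toSet :=
      closedBall_subset_closedBall (show ρ ≤ whitneyScale Ω t x / 4 by linarith)
    have h6 := Cube.abs_avg_sub_avg_le_osc h5 (hint Q (hQ.trans Set.sdiff_subset))
    rw [hs, show Cube.side ⟨_, ρ, hρ0⟩ = 2 * ρ from rfl] at h6
    refine h6.trans (mul_le_mul ?_ ((hR Q hQ).1 (by rw [hs]; linarith)) (Q.osc_nonneg f)
      (by positivity))
    exact pow_le_pow_left₀ (div_nonneg (by linarith) (by positivity))
      (div_le_div_of_nonneg_right (by linarith) (by positivity)) n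
  have hCθ : C * θ = η := by rw [hθ]; field_simp
  rw [h0] at hchain
  rw [abs_le] at *
  rw [← hCθ, hC]
  constructor <;> linarith

section norms

variable {U : Set (Fin n → ℝ)} {lam : ℝ} {f g : (Fin n → ℝ) → ℝ}

theorem omegaOn_nonneg (U : Set (Fin n → ℝ)) (f : (Fin n → ℝ) → ℝ) (t : ℝ) :
    0 ≤ omegaOn U f t := by
  refine Real.sSup_nonneg ?_
  rintro _ ⟨Q, -, -, rfl⟩
  exact Q.osc_nonneg f

theorem bigAvgSup_nonneg (U : Set (Fin n → ℝ)) (lam : ℝ) (f : (Fin n → ℝ) → ℝ) :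
    0 ≤ bigAvgSup U lam f := by
  refine Real.sSup_nonneg ?_
  rintro _ ⟨Q, -, -, rfl⟩
  exact Q.avgAbs_nonneg f

theorem bmoNorm_nonneg (U : Set (Fin n → ℝ)) (lam : ℝ) (f : (Fin n → ℝ) → ℝ) :
    0 ≤ bmoNorm U lam f :=
  add_nonneg (omegaOn_nonneg U f lam) (bigAvgSup_nonneg U lam f)

theorem omegaOn_le {t η : ℝ} (hη : 0 ≤ η)
    (h : ∀ Q : Cube n, Q.toSet ⊆ U → Q.side < t → Q.osc f ≤ η) : omegaOn U f t ≤ η := by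
  refine Real.sSup_le ?_ hη
  rintro _ ⟨Q, hQ, hs, rfl⟩
  exact h Q hQ hs

theorem bigAvgSup_le {η : ℝ} (hη : 0 ≤ η)
    (h : ∀ Q : Cube n, Q.toSet ⊆ U → lam ≤ Q.side → Q.avgAbs f ≤ η) :
    bigAvgSup U lam f ≤ η := by
  refine Real.sSup_le ?_ hη
  rintro _ ⟨Q, hQ, hs, rfl⟩
  exact h Q hQ hs

theorem MemBmo.mono (hf : MemBmo U lam f) {V : Set (Fin n → ℝ)} (hV : V ⊆ U) :
    MemBmo V lam f := by
  refine ⟨fun Q hQ => hf.1 Q (hQ.trans hV), hf.2.1.mono ?_, hf.2.2.mono ?_⟩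
  all_goals
    rintro _ ⟨Q, hQ, hs, rfl⟩
    exact ⟨Q, hQ.trans hV, hs, rfl⟩

theorem MemBmo.osc_le_omegaOn (hf : MemBmo U lam f) {t : ℝ} (ht : t ≤ lam) {Q : Cube n}
    (hQ : Q.toSet ⊆ U) (hs : Q.side < t) : Q.osc f ≤ omegaOn U f t := by
  refine le_csSup (hf.2.1.mono ?_) ⟨Q, hQ, hs, rfl⟩
  rintro _ ⟨P, hP, hPs, rfl⟩
  exact ⟨P, hP, hPs.trans_le ht, rfl⟩

theorem MemBmo.osc_le (hf : MemBmo U lam f) {Q : Cube n} (hQ : Q.toSet ⊆ U)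
    (hs : Q.side < lam) : Q.osc f ≤ bmoNorm U lam f :=
  (hf.osc_le_omegaOn le_rfl hQ hs).trans (le_add_of_nonneg_right (bigAvgSup_nonneg U lam f))

theorem MemBmo.avgAbs_le (hf : MemBmo U lam f) {Q : Cube n} (hQ : Q.toSet ⊆ U)
    (hs : lam ≤ Q.side) : Q.avgAbs f ≤ bmoNorm U lam f :=
  (le_csSup hf.2.2 ⟨Q, hQ, hs, rfl⟩ : _ ≤ bigAvgSup U lam f).trans
    (le_add_of_nonneg_left (omegaOn_nonneg U f lam))

theorem Continuous.integrableOn_cube (hg : Continuous g) (Q : Cube n) :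
    IntegrableOn g Q.toSet :=
  hg.continuousOn.integrableOn_compact Q.isCompact_toSet

theorem MemBmo.sub_of_hasCompactSupport (hf : MemBmo U lam f) (hg : Continuous g)
    (hgs : HasCompactSupport g) : MemBmo U lam (f - g) := by
  obtain ⟨M, hM⟩ := hgs.exists_bound_of_continuous hg
  have hgM : ∀ Q : Cube n, Q.avgAbs g ≤ M := fun Q =>
    Cube.avgAbs_le_of_forall_le (hg.integrableOn_cube Q) fun x _ => hM x
  obtain ⟨⟨A, hA⟩, ⟨B, hB⟩⟩ := hf.2
  refine ⟨fun Q hQ => (hf.1 Q hQ).sub (hg.integrableOn_cube Q), ⟨A + 2 * M, ?_⟩, ⟨B + M, ?_⟩⟩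
  · rintro _ ⟨Q, hQ, hs, rfl⟩
    have h1 := Q.osc_sub_le (hf.1 Q hQ) (hg.integrableOn_cube Q)
    have h2 := Q.osc_le_two_mul_avgAbs (hg.integrableOn_cube Q)
    have h3 := hA ⟨Q, hQ, hs, rfl⟩
    linarith [hgM Q]
  · rintro _ ⟨Q, hQ, hs, rfl⟩
    have h1 : Q.avgAbs (f - g) ≤ Q.avgAbs f + Q.avgAbs g :=
      Cube.avgAbs_le_add ((hf.1 Q hQ).sub (hg.integrableOn_cube Q)) (hf.1 Q hQ)
        (hg.integrableOn_cube Q) fun x _ => abs_sub (f x) (g x)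
    have h3 := hB ⟨Q, hQ, hs, rfl⟩
    linarith [hgM Q]

end norms

theorem exists_osc_le_of_hasCompactSupport {g : (Fin n → ℝ) → ℝ} (hg : Continuous g)
    (hgs : HasCompactSupport g) {η : ℝ} (hη : 0 < η) :
    ∃ t > 0, ∀ Q : Cube n, Q.side < t → Q.osc g ≤ η := by
  obtain ⟨t, ht, h⟩ := Metric.uniformContinuous_iff.1
    (hgs.uniformContinuous_of_continuous hg) (η / 2) (half_pos hη)
  refine ⟨t, ht, fun Q hQ => ?_⟩
  have hQ' : 2 * Q.half < t := hQ
  refine (Q.osc_le_two_mul (hg.integrableOn_cube Q) (g Q.center)).trans ?_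
  have : Q.avgAbs (fun x => g x - g Q.center) ≤ η / 2 :=
    Cube.avgAbs_le_of_forall_le ((hg.sub continuous_const).integrableOn_cube Q) fun x hx => by
      have hx' : dist x Q.center ≤ Q.half := hx
      exact (h (by linarith [Q.half_pos])).le
  linarith

section closure

variable {U : Set (Fin n → ℝ)} {lam : ℝ} {f : (Fin n → ℝ) → ℝ}

theorem InCmoClosure.exists_bmoNorm_lt (h : InCmoClosure U lam f) {η : ℝ} (hη : 0 < η) :
    ∃ g : (Fin n → ℝ) → ℝ, Continuous g ∧ HasCompactSupport g ∧ bmoNorm U lam (f - g) < η := by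
  obtain ⟨g, hg, hlim⟩ := h
  obtain ⟨j, hj⟩ := (hlim.eventually_lt_const hη).exists
  exact ⟨g j, (hg j).1, (hg j).2.1, hj⟩

theorem InCmoClosure.vanishSmallOsc (h : InCmoClosure U lam f) (hf : MemBmo U lam f)
    (hlam : 0 < lam) : VanishSmallOsc U f := by
  refine tendsto_order.2 ⟨fun a ha => Eventually.of_forall fun t =>
    ha.trans_le (omegaOn_nonneg U f t), fun a ha => ?_⟩
  obtain ⟨g, hg, hgs, hfg⟩ := h.exists_bmoNorm_lt (show 0 < a / 3 by positivity)
  obtain ⟨t, ht, hosc⟩ := exists_osc_le_of_hasCompactSupport hg hgs (show 0 < a / 3 by positivity)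
  filter_upwards [Ioo_mem_nhdsGT (lt_min ht hlam)] with s hs
  refine (omegaOn_le (show 0 ≤ a / 3 + a / 3 by positivity) fun Q hQ hQs => ?_).trans_lt
    (show a / 3 + a / 3 < a by linarith)
  have hs' := lt_min_iff.1 hs.2
  have h1 := (hf.sub_of_hasCompactSupport hg hgs).osc_le hQ (hQs.trans hs'.2)
  have h2 := Q.osc_le_add_osc_sub (hf.1 Q hQ) (hg.integrableOn_cube Q)
  linarith [hosc Q (hQs.trans hs'.1)]

theorem InCmoClosure.vanishAtInfinity (h : InCmoClosure U lam f) (hf : MemBmo U lam f) :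
    VanishAtInfinity U lam f := by
  refine tendsto_order.2 ⟨fun a ha => Eventually.of_forall fun t =>
    ha.trans_le (bmoNorm_nonneg _ lam f), fun a ha => ?_⟩
  obtain ⟨g, hg, hgs, hfg⟩ := h.exists_bmoNorm_lt (show 0 < a / 3 by positivity)
  obtain ⟨R₀, hR₀⟩ := hgs.isCompact.isBounded.subset_closedBall (0 : Fin n → ℝ)
  have hfg' := hf.sub_of_hasCompactSupport hg hgs
  filter_upwards [eventually_ge_atTop R₀] with R hR
  have heq : ∀ Q : Cube n, Q.toSet ⊆ U \ closedBall 0 R → Set.EqOn f (f - g) Q.toSet :=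
    fun Q hQ x hx => by
      have : g x = 0 := image_eq_zero_of_notMem_tsupport fun hx' =>
        (hQ hx).2 (closedBall_subset_closedBall hR (hR₀ hx'))
      simp [this]
  have h1 : omegaOn (U \ closedBall 0 R) f lam ≤ a / 3 :=
    omegaOn_le (by positivity) fun Q hQ hs => by
      rw [Cube.osc_congr (heq Q hQ)]
      exact (hfg'.osc_le (hQ.trans Set.sdiff_subset) hs).trans hfg.le
  have h2 : bigAvgSup (U \ closedBall 0 R) lam f ≤ a / 3 :=
    bigAvgSup_le (by positivity) fun Q hQ hs => by
      rw [Cube.avgAbs_congr (heq Q hQ)]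
      exact (hfg'.avgAbs_le (hQ.trans Set.sdiff_subset) hs).trans hfg.le
  unfold bmoNorm
  linarith

end closure

theorem lamED_pos (hn : 0 < n) {ε δ : ℝ} (hε : 0 < ε) (hδ : 0 < δ) : 0 < lamED n ε δ := by
  have : (0 : ℝ) < n := Nat.cast_pos.2 hn
  unfold lamED
  positivity

theorem lamED_lt (hn : 0 < n) {ε δ : ℝ} (hε : 0 < ε) (hε1 : ε ≤ 1) (hδ : 0 < δ) :
    lamED n ε δ < ε * δ / 4 := by
  have hn1 : (1 : ℝ) ≤ n := Nat.one_le_cast.2 hn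
  have hs : 0 ≤ √(n : ℝ) * ε := by positivity
  have hd : 320 ≤ 320 * (n : ℝ) * (1 + √n * ε) := by nlinarith
  unfold lamED
  rw [div_lt_iff₀ (by linarith)]
  have hεδ : 0 < ε * δ := mul_pos hε hδ
  nlinarith

theorem IsEpsDeltaDomain.exists_contDiff_bmoNorm_le {Ω : Set (Fin n → ℝ)} {ε δ : ℝ} (hn : 0 < n)
    (hΩ : IsRealDomain Ω) (hed : IsEpsDeltaDomain Ω ε δ) (hε : 0 < ε) (hε1 : ε ≤ 1) (hδ : 0 < δ)
    {lam : ℝ} (hlam : 0 < lam) (hlam' : lam < ε * δ / 4) {f : (Fin n → ℝ) → ℝ}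
    (hf : MemBmo Ω lam f) (hinf : VanishAtInfinity Ω lam f) (hosc : VanishSmallOsc Ω f)
    {η : ℝ} (hη : 0 < η) :
    ∃ g : (Fin n → ℝ) → ℝ, (ContDiff ℝ (⊤ : ℕ∞) g ∧ HasCompactSupport g ∧ tsupport g ⊆ Ω) ∧
      bmoNorm Ω lam (f - g) ≤ η := by
  have hC := approxConst_pos n
  set η' := η / (3 * approxConst n) with hη'
  have hη0 : 0 < η' := by positivity
  have hCη : 3 * (approxConst n * η') = η := by rw [hη']; field_simp
  obtain ⟨r, hrω, hr, hrl⟩ := ((hosc.eventually_lt_const hη0).and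
    (Ioo_mem_nhdsGT hlam)).exists
  have hwhit := hed.exists_abs_whitneyAvg_le hn hε hε1 hδ hΩ.2.isPreconnected hf.1 (half_pos hr)
    (by linarith) hlam' (fun θ hθ => by
      obtain ⟨R, hR⟩ := (hinf.eventually_lt_const hθ).exists
      have hfR := hf.mono (Set.sdiff_subset (s := Ω) (t := closedBall 0 R))
      exact ⟨R, fun Q hQ => ⟨fun hs => (hfR.osc_le hQ hs).trans hR.le,
        fun hs => (hfR.avgAbs_le hQ hs).trans hR.le⟩⟩) hη0
  obtain ⟨g, hg, hgs, hgΩ, hsmall, hbig⟩ := exists_contDiff_approx hn hΩ.1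
    (hed.compl_nonempty hn hε hδ) hf.1 (half_pos hr) hη0
    (fun Q hQ hs => (hf.osc_le_omegaOn hrl.le hQ (by linarith)).trans hrω.le) hwhit
  refine ⟨g, ⟨hg, hgs, hgΩ⟩, ?_⟩
  have h0 : 0 < approxConst n * η' := by positivity
  have h1 : omegaOn Ω (f - g) lam ≤ 2 * (approxConst n * η') :=
    omegaOn_le (by positivity) fun Q hQ _ => by
      rcases le_total Q.side (r / 2) with h | h
      · linarith [hsmall Q hQ h]
      · linarith [hbig Q hQ h, Q.osc_le_two_mul_avgAbs
          ((hf.1 Q hQ).sub (hg.continuous.integrableOn_cube Q))]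
  have h2 : bigAvgSup Ω lam (f - g) ≤ approxConst n * η' :=
    bigAvgSup_le h0.le fun Q hQ hs => hbig Q hQ (by linarith)
  unfold bmoNorm
  linarith

/-- On an (ε,δ)-domain with λ = λ_{ε,δ}: for f ∈ bmo_λ(Ω) the following are equivalent:
approximability by continuous functions with compact support in Ω, approximability by C^∞
functions with compact support in Ω, and (vanishing at infinity together with vanishing
mean oscillation). -/
theorem stmt19 {n : ℕ} (hn : 0 < n) (ε δ : ℝ) (hε : 0 < ε) (hε1 : ε ≤ 1) (hδ : 0 < δ)
    (Ω : Set (Fin n → ℝ)) (hΩ : IsRealDomain Ω) (hed : IsEpsDeltaDomain Ω ε δ)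
    (f : (Fin n → ℝ) → ℝ) (hf : MemBmo Ω (lamED n ε δ) f) :
    (InCmoClosure Ω (lamED n ε δ) f ↔
      ∃ g : ℕ → (Fin n → ℝ) → ℝ,
        (∀ j, ContDiff ℝ (⊤ : ℕ∞) (g j) ∧ HasCompactSupport (g j) ∧ tsupport (g j) ⊆ Ω) ∧
        Tendsto (fun j => bmoNorm Ω (lamED n ε δ) (f - g j)) atTop (nhds 0)) ∧
    (InCmoClosure Ω (lamED n ε δ) f ↔
      (VanishAtInfinity Ω (lamED n ε δ) f ∧ VanishSmallOsc Ω f)) := by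
  have hlam := lamED_pos hn hε hδ
  have h12 : InCmoClosure Ω (lamED n ε δ) f →
      VanishAtInfinity Ω (lamED n ε δ) f ∧ VanishSmallOsc Ω f := fun h =>
    ⟨h.vanishAtInfinity hf, h.vanishSmallOsc hf hlam⟩
  have h23 : VanishAtInfinity Ω (lamED n ε δ) f ∧ VanishSmallOsc Ω f →
      ∃ g : ℕ → (Fin n → ℝ) → ℝ,
        (∀ j, ContDiff ℝ (⊤ : ℕ∞) (g j) ∧ HasCompactSupport (g j) ∧ tsupport (g j) ⊆ Ω) ∧
        Tendsto (fun j => bmoNorm Ω (lamED n ε δ) (f - g j)) atTop (nhds 0) := fun h => by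
    choose g hg hgn using fun j : ℕ => hed.exists_contDiff_bmoNorm_le hn hΩ hε hε1 hδ hlam
      (lamED_lt hn hε hε1 hδ) hf h.1 h.2 (Nat.one_div_pos_of_nat (α := ℝ) (n := j))
    exact ⟨g, hg, squeeze_zero (fun _ => bmoNorm_nonneg _ _ _) hgn
      tendsto_one_div_add_atTop_nhds_zero_nat⟩
  have h31 : (∃ g : ℕ → (Fin n → ℝ) → ℝ,
      (∀ j, ContDiff ℝ (⊤ : ℕ∞) (g j) ∧ HasCompactSupport (g j) ∧ tsupport (g j) ⊆ Ω) ∧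
      Tendsto (fun j => bmoNorm Ω (lamED n ε δ) (f - g j)) atTop (nhds 0)) →
      InCmoClosure Ω (lamED n ε δ) f := fun ⟨g, hg, hlim⟩ =>
    ⟨g, fun j => ⟨(hg j).1.continuous, (hg j).2⟩, hlim⟩
  exact ⟨⟨h23 ∘ h12, h31⟩, ⟨h12, h31 ∘ h23⟩⟩
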